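/- There exists an absolute constant C > 0 such that for every reduced rational α = v/w ∈ (0,1] and every real U ≥ 2, the count R_{4,α}(U) of quadruples (p,q,n,k) ∈ ℕ⁴ satisfying gcd(p,q) = 1, 1 ≤ q < p, U < p, 2 ≤ nq + kp ≤ U², 1 ≤ k < n ≤ U, and inv_p(q) ≤ α·p, obeys | R_{4,α}(U) − α U⁴ (log U)²/(4ζ(2)) − (α U⁴ log U/(2ζ(2)))·(γ − log 2) | ≤ C·U⁴, where γ is the Euler–Mascheroni constant. -/

import Mathlib

/-- `inv_p(q)`: the least positive integer in the residue class `q⁻¹ (mod p)`. -/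
def modInv (p q : ℕ) : ℕ := if ((q : ZMod p)⁻¹).val = 0 then p else ((q : ZMod p)⁻¹).val

/-- The system of Case 4: `gcd(p,q) = 1`, `1 ≤ q < p`, `U < p`, `2 ≤ nq + kp ≤ U²`,
`1 ≤ k < n ≤ U`, `inv_p(q) ≤ α·p`. -/
def Case4 (α : ℚ) (U : ℝ) (p q n k : ℕ) : Prop :=
  Nat.gcd p q = 1 ∧ 1 ≤ q ∧ q < p ∧ U < (p : ℝ) ∧
  2 ≤ n * q + k * p ∧ ((n * q + k * p : ℕ) : ℝ) ≤ U ^ 2 ∧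
  1 ≤ k ∧ k < n ∧ (n : ℝ) ≤ U ∧ (modInv p q : ℝ) ≤ (α : ℝ) * p

namespace C4
open Finset

noncomputable def Kl (q : ℕ) [NeZero q] (a b : ZMod q) : ℂ :=
  ∑ u : (ZMod q)ˣ, ZMod.stdAddChar (a * (u : ZMod q) + b * ((u⁻¹ : (ZMod q)ˣ) : ZMod q))

lemma orth {q : ℕ} [NeZero q] (t : ZMod q) :
    ∑ a : ZMod q, ZMod.stdAddChar (a * t) = if t = 0 then (q : ℂ) else 0 := by
  have := AddChar.sum_mulShift (ψ := ZMod.stdAddChar (N := q)) t (ZMod.isPrimitive_stdAddChar q)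
  simpa [ZMod.card] using this

lemma moment2 {q : ℕ} [NeZero q] {X : Type*} [Fintype X] (f g : X → ZMod q) :
    ∑ a : ZMod q, ∑ b : ZMod q, ‖∑ x, ZMod.stdAddChar (a * f x + b * g x)‖ ^ 2
      = (q : ℝ) ^ 2 * (#{z : X × X | f z.1 = f z.2 ∧ g z.1 = g z.2} : ℝ) := by
  have key : ∀ a b : ZMod q, ((‖∑ x, ZMod.stdAddChar (a * f x + b * g x)‖ ^ 2 : ℝ) : ℂ)
      = ∑ z : X × X, ZMod.stdAddChar (a * (f z.1 - f z.2)) * ZMod.stdAddChar (b * (g z.1 - g z.2)) := by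
    intro a b
    rw [Complex.ofReal_pow, ← Complex.mul_conj', map_sum, Finset.sum_mul_sum, ← Finset.univ_product_univ,
      Finset.sum_product]
    refine Finset.sum_congr rfl fun x _ => Finset.sum_congr rfl fun y _ => ?_
    rw [← AddChar.map_neg_eq_conj, ← AddChar.map_add_eq_mul, ← AddChar.map_add_eq_mul]
    congr 1; ring
  have : ((∑ a : ZMod q, ∑ b : ZMod q, ‖∑ x, ZMod.stdAddChar (a * f x + b * g x)‖ ^ 2 : ℝ) : ℂ)
      = (((q : ℝ) ^ 2 * (#{z : X × X | f z.1 = f z.2 ∧ g z.1 = g z.2} : ℝ) : ℝ) : ℂ) := by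
    push_cast only [Complex.ofReal_sum]
    simp_rw [key]
    have : ∀ a : ZMod q, ∑ b : ZMod q, ∑ z : X × X, (ZMod.stdAddChar (a * (f z.1 - f z.2)) * ZMod.stdAddChar (b * (g z.1 - g z.2)) : ℂ) =
      ∑ z : X × X, ZMod.stdAddChar (a * (f z.1 - f z.2)) * (if g z.1 - g z.2 = 0 then (q : ℂ) else 0) := by
      intro a
      rw [Finset.sum_comm]
      refine Finset.sum_congr rfl fun z _ => ?_
      rw [← Finset.mul_sum, orth]
    simp_rw [this]
    rw [Finset.sum_comm]
    have : ∀ z : X × X, ∑ a : ZMod q, (ZMod.stdAddChar (a * (f z.1 - f z.2)) * (if g z.1 - g z.2 = 0 then (q : ℂ) else 0) : ℂ) = if f z.1 = f z.2 ∧ g z.1 = g z.2 then (q : ℂ) ^ 2 else 0 := by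
      intro z
      rw [← Finset.sum_mul, orth]
      simp only [sub_eq_zero]
      split_ifs <;> simp_all [sq]
    simp_rw [this]
    rw [← Finset.sum_filter, Finset.sum_const]
    simp [mul_comm]
  exact_mod_cast this

/-- number of x killed by c -/
def G {q : ℕ} [NeZero q] (c : ZMod q) : ℕ := #{x : ZMod q | c * x = 0}

lemma fiber_le {q : ℕ} [NeZero q] (c y : ZMod q) : #{x : ZMod q | c * x = y} ≤ G c := by
  by_cases h : ∃ x0, c * x0 = y
  · obtain ⟨x0, h0⟩ := h
    refine Finset.card_le_card_of_injOn (fun x => x - x0) ?_ ?_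
    · intro x hx
      simp at hx ⊢
      rw [mul_sub, hx, h0, sub_self]
    · intro x _ y _ h
      simpa using h
  · push Not at h
    rw [Finset.filter_false_of_mem (by simpa using h)]
    simp

lemma G_mul_le {q : ℕ} [NeZero q] (c d : ZMod q) : G (c * d) ≤ G c * G d := by
  unfold G
  have := Finset.card_le_mul_card_image (f := fun x => d * x) ({x : ZMod q | c * d * x = 0} : Finset (ZMod q)) (G d) (by
    intro b _
    refine le_trans (Finset.card_le_card ?_) (fiber_le d b)
    intro x; simp)
  refine this.trans ?_
  rw [mul_comm]
  refine Nat.mul_le_mul_right _ (Finset.card_le_card ?_)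
  intro x hx
  simp at hx ⊢
  obtain ⟨a, h1, rfl⟩ := hx
  rw [← mul_assoc, h1]

lemma G_le_gcd {q : ℕ} [NeZero q] (b : ℕ) : G (b : ZMod q) ≤ Nat.gcd b q := by
  have hg : 0 < Nat.gcd b q := Nat.gcd_pos_of_pos_right _ (NeZero.pos q)
  refine le_trans (Finset.card_le_card ?_) (IsAddCyclic.card_nsmul_eq_zero_le (α := ZMod q) hg)
  intro x hx
  simp at hx ⊢
  have := Nat.gcd_eq_gcd_ab b q
  have h2 : ((Nat.gcd b q : ℤ) : ZMod q) = ((b * Nat.gcdA b q + q * Nat.gcdB b q : ℤ) : ZMod q) := by rw [this]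
  push_cast at h2
  rw [h2]
  simp
  have h3 : (b : ZMod q) * ((Nat.gcdA b q : ℤ) : ZMod q) * x = (b * x) * ((Nat.gcdA b q : ℤ) : ZMod q) := by ring
  rw [h3, hx, zero_mul]

lemma sum_gcd_le (q : ℕ) [NeZero q] : ∑ c : ZMod q, G c ≤ q * #q.divisors := by
  have h1 : ∑ c : ZMod q, G c ≤ ∑ c : ZMod q, Nat.gcd c.val q := by
    refine Finset.sum_le_sum fun c _ => ?_
    conv_lhs => rw [← ZMod.natCast_zmod_val c]
    exact G_le_gcd _
  refine h1.trans ?_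
  have h2 : ∑ c : ZMod q, Nat.gcd c.val q = ∑ c ∈ range q, Nat.gcd c q := by
    refine Finset.sum_bij (fun c _ => c.val) ?_ ?_ ?_ ?_
    · intro c _; simpa using ZMod.val_lt c
    · intro a _ b _ h; exact ZMod.val_injective q h
    · intro b hb; exact ⟨b, by simp, ZMod.val_cast_of_lt (by simpa using hb)⟩
    · intros; rfl
  rw [h2]
  have h3 : ∀ c ∈ range q, Nat.gcd c q ≤ ∑ d ∈ q.divisors, if d ∣ c then d else 0 := by
    intro c _
    have : Nat.gcd c q ∈ q.divisors := by simp [Nat.gcd_dvd_right, NeZero.ne q]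
    refine le_trans ?_ (Finset.single_le_sum (f := fun d => if d ∣ c then d else 0) (by intros; positivity) this)
    simp [Nat.gcd_dvd_left]
  refine (Finset.sum_le_sum h3).trans ?_
  rw [Finset.sum_comm, mul_comm, ← smul_eq_mul]
  refine Finset.sum_le_card_nsmul _ _ _ ?_
  intro d hd
  have hd' := Nat.dvd_of_mem_divisors hd
  rw [← Finset.sum_filter, Finset.sum_const, smul_eq_mul]
  have : #{c ∈ range q | d ∣ c} ≤ q / d := by
    have h := Nat.count_modEq_card (r := d) q (Nat.pos_of_mem_divisors hd) 0
    rw [Nat.count_eq_card_filter_range] at h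
    have h4 : q % d = 0 := Nat.mod_eq_zero_of_dvd hd'
    simp [h4] at h
    rw [← h]
    refine Finset.card_le_card ?_
    intro c; simp [Nat.modEq_zero_iff_dvd]
  calc _ ≤ q / d * d := Nat.mul_le_mul_right _ this
    _ = q := Nat.div_mul_cancel hd'
end C4

namespace C4
open Finset

def Nsol (q : ℕ) [NeZero q] : ℕ :=
  #{z : ((ZMod q)ˣ × (ZMod q)ˣ) × ((ZMod q)ˣ × (ZMod q)ˣ) |
    (z.1.1 : ZMod q) + z.1.2 = z.2.1 + z.2.2 ∧
    ((z.1.1⁻¹ : (ZMod q)ˣ) : ZMod q) + ((z.1.2⁻¹ : (ZMod q)ˣ) : ZMod q)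
      = ((z.2.1⁻¹ : (ZMod q)ˣ) : ZMod q) + ((z.2.2⁻¹ : (ZMod q)ˣ) : ZMod q)}

lemma sol_eq {R : Type*} [CommRing R] (x y z w : Rˣ) (h1 : (x : R) + y = z + w)
    (h2 : ((x⁻¹ : Rˣ) : R) + ((y⁻¹ : Rˣ) : R) = ((z⁻¹ : Rˣ) : R) + ((w⁻¹ : Rˣ) : R)) :
    2 * ((x : R) - z) * ((y : R) - z) * z
      = - (((x : R) - z) * ((y : R) - z) * ((x - z) + (y - z))) := by
  have hx := x.mul_inv
  have hy := y.mul_inv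
  have hz := z.mul_inv
  have hw := w.mul_inv
  set X : R := (x : R)
  set Y : R := (y : R)
  set Z : R := (z : R)
  set W : R := (w : R)
  set X' : R := ((x⁻¹ : Rˣ) : R)
  set Y' : R := ((y⁻¹ : Rˣ) : R)
  set Z' : R := ((z⁻¹ : Rˣ) : R)
  set W' : R := ((w⁻¹ : Rˣ) : R)
  have e1 : (X + Y) * Z * W = (Z + W) * X * Y := by
    have : X * Y * Z * W * (X' + Y') = X * Y * Z * W * (Z' + W') := by rw [h2]
    have a1 : X * Y * Z * W * (X' + Y') = (X * X') * (Y * Z * W) + (Y * Y') * (X * Z * W) := by ring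
    have a2 : X * Y * Z * W * (Z' + W') = (Z * Z') * (X * Y * W) + (W * W') * (X * Y * Z) := by ring
    rw [a1, a2, hx, hy, hz, hw] at this
    linear_combination this
  have e2 : W = X + Y - Z := by linear_combination -h1
  rw [e2] at e1
  linear_combination -e1

lemma Nsol_le (q : ℕ) [NeZero q] : Nsol q ≤ 2 * q ^ 2 * (#q.divisors) ^ 2 := by
  have hT : Nsol q ≤ #{t : ZMod q × ZMod q × ZMod q | 2 * t.1 * t.2.1 * t.2.2 = - (t.1 * t.2.1 * (t.1 + t.2.1))} := by
    unfold Nsol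
    refine Finset.card_le_card_of_injOn (fun z => ((z.1.1 : ZMod q) - z.2.1, (z.1.2 : ZMod q) - z.2.1, (z.2.1 : ZMod q))) ?_ ?_
    · intro z hz
      simp only [coe_filter, mem_univ, true_and, Set.mem_ofPred_eq] at hz ⊢
      exact sol_eq _ _ _ _ hz.1 hz.2
    · rintro ⟨⟨x, y⟩, ⟨z, w⟩⟩ h1 ⟨⟨x', y'⟩, ⟨z', w'⟩⟩ h2 h
      simp only [coe_filter, mem_univ, true_and, Set.mem_ofPred_eq, Prod.mk.injEq] at h1 h2 h ⊢
      obtain ⟨ha, hb, hc⟩ := h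
      rw [hc] at ha hb
      have hx : (x : ZMod q) = x' := by linear_combination ha
      have hy : (y : ZMod q) = y' := by linear_combination hb
      have hw : (w : ZMod q) = w' := by linear_combination h2.1 - h1.1 + hx + hy - hc
      exact ⟨⟨Units.ext hx, Units.ext hy⟩, Units.ext hc, Units.ext hw⟩
  refine hT.trans ?_
  have h2 : G (2 : ZMod q) ≤ 2 := by
    have := G_le_gcd (q := q) 2
    push_cast at this
    exact this.trans (Nat.gcd_le_left _ (by norm_num))
  rw [Finset.card_filter, ← Finset.univ_product_univ, Finset.sum_product]
  have : ∀ u : ZMod q, ∑ y : ZMod q × ZMod q, (if 2 * u * y.1 * y.2 = - (u * y.1 * (u + y.1)) then 1 else 0)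
      ≤ ∑ v : ZMod q, 2 * G u * G v := by
    intro u
    rw [← Finset.univ_product_univ, Finset.sum_product]
    refine Finset.sum_le_sum fun v _ => ?_
    rw [← Finset.card_filter]
    change #{i : ZMod q | 2 * u * v * i = -(u * v * (u + v))} ≤ 2 * G u * G v
    refine (fiber_le (q := q) (2 * u * v) _).trans ((G_mul_le _ _).trans ?_)
    refine Nat.mul_le_mul_right _ ((G_mul_le _ _).trans (Nat.mul_le_mul_right _ h2))
  refine (Finset.sum_le_sum fun u _ => this u).trans ?_
  calc _ = 2 * (∑ u : ZMod q, G u) * (∑ u : ZMod q, G u) := by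
        simp_rw [← Finset.mul_sum]; rw [← Finset.sum_mul, ← Finset.mul_sum]
    _ ≤ 2 * (q * #q.divisors) * (q * #q.divisors) := by
        gcongr <;> exact sum_gcd_le q
    _ = _ := by ring

lemma moment4 (q : ℕ) [NeZero q] :
    ∑ a : ZMod q, ∑ b : ZMod q, ‖Kl q a b‖ ^ 4 ≤ 2 * (q : ℝ) ^ 4 * (#q.divisors : ℝ) ^ 2 := by
  have h := moment2 (q := q) (X := (ZMod q)ˣ × (ZMod q)ˣ) (fun z => (z.1 : ZMod q) + (z.2 : ZMod q))
    (fun z => ((z.1⁻¹ : (ZMod q)ˣ) : ZMod q) + ((z.2⁻¹ : (ZMod q)ˣ) : ZMod q))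
  have e : ∀ a b : ZMod q, ‖Kl q a b‖ ^ 4 = ‖∑ x : (ZMod q)ˣ × (ZMod q)ˣ, ZMod.stdAddChar (a * ((x.1 : ZMod q) + (x.2 : ZMod q)) + b * (((x.1⁻¹ : (ZMod q)ˣ) : ZMod q) + ((x.2⁻¹ : (ZMod q)ˣ) : ZMod q)))‖ ^ 2 := by
    intro a b
    have : ‖Kl q a b‖ ^ 4 = ‖Kl q a b * Kl q a b‖ ^ 2 := by rw [norm_mul]; ring
    rw [this]
    congr 2
    unfold Kl
    rw [Finset.sum_mul_sum, ← Finset.univ_product_univ, Finset.sum_product]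
    refine Finset.sum_congr rfl fun x _ => Finset.sum_congr rfl fun y _ => ?_
    rw [← AddChar.map_add_eq_mul]
    congr 1; ring
  simp_rw [e]
  rw [h]
  have := Nsol_le q
  unfold Nsol at this
  have h3 : (#{z : ((ZMod q)ˣ × (ZMod q)ˣ) × ((ZMod q)ˣ × (ZMod q)ˣ) |
    (z.1.1 : ZMod q) + z.1.2 = z.2.1 + z.2.2 ∧
    ((z.1.1⁻¹ : (ZMod q)ˣ) : ZMod q) + ((z.1.2⁻¹ : (ZMod q)ˣ) : ZMod q)
      = ((z.2.1⁻¹ : (ZMod q)ˣ) : ZMod q) + ((z.2.2⁻¹ : (ZMod q)ˣ) : ZMod q)} : ℝ) ≤ 2 * q ^ 2 * (#q.divisors) ^ 2 := by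
    exact_mod_cast this
  calc _ ≤ (q:ℝ)^2 * (2 * q ^ 2 * (#q.divisors) ^ 2) := by gcongr
    _ = _ := by ring

lemma Kl_shift {q : ℕ} [NeZero q] (a b : ZMod q) (v : (ZMod q)ˣ) :
    Kl q (a * v) (b * ((v⁻¹ : (ZMod q)ˣ) : ZMod q)) = Kl q a b := by
  unfold Kl
  refine Fintype.sum_equiv (Equiv.mulLeft v) _ _ ?_
  intro u
  simp only [Equiv.coe_mulLeft, Units.val_mul, mul_inv_rev]
  congr 1; ring

lemma totient_div (q : ℕ) [NeZero q] : (q : ℝ) ≤ #q.divisors * (q.totient : ℝ) := by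
  have h := Nat.sum_totient q
  have : ∑ m ∈ q.divisors, m.totient ≤ #q.divisors • q.totient :=
    Finset.sum_le_card_nsmul _ _ _ fun d hd =>
      Nat.le_of_dvd (Nat.totient_pos.2 (NeZero.pos q)) (Nat.totient_dvd_of_dvd (Nat.dvd_of_mem_divisors hd))
  rw [h, smul_eq_mul] at this
  exact_mod_cast this

lemma Kl_bound4 {q : ℕ} [NeZero q] (a b : ZMod q) :
    ‖Kl q a b‖ ^ 4 ≤ 2 * (q : ℝ) ^ 3 * (#q.divisors : ℝ) ^ 3 * G b := by
  have h1 : (q.totient : ℝ) * ‖Kl q a b‖ ^ 4 ≤ G b * (2 * (q : ℝ) ^ 4 * (#q.divisors : ℝ) ^ 2) := by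
    have e : (q.totient : ℝ) * ‖Kl q a b‖ ^ 4 =
        ∑ v : (ZMod q)ˣ, ‖Kl q (a * v) (b * ((v⁻¹ : (ZMod q)ˣ) : ZMod q))‖ ^ 4 := by
      simp_rw [Kl_shift]
      simp [ZMod.card_units_eq_totient]
    rw [e]
    have := moment4 q
    rw [← Finset.sum_product'] at this
    refine le_trans ?_ (mul_le_mul_of_nonneg_left this (Nat.cast_nonneg _))
    rw [← Finset.sum_fiberwise (s := (univ : Finset (ZMod q)ˣ)) (g := fun v => ((a * v, b * ((v⁻¹ : (ZMod q)ˣ) : ZMod q)) : ZMod q × ZMod q))]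
    rw [Finset.mul_sum, Finset.univ_product_univ]
    refine Finset.sum_le_sum ?_
    intro t _
    have h5 : ∀ v ∈ ({v : (ZMod q)ˣ | ((a * v, b * ((v⁻¹ : (ZMod q)ˣ) : ZMod q)) : ZMod q × ZMod q) = t} : Finset (ZMod q)ˣ), ‖Kl q (a * v) (b * ((v⁻¹ : (ZMod q)ˣ) : ZMod q))‖ ^ 4 = ‖Kl q t.1 t.2‖ ^ 4 := by
      intro v hv
      simp only [mem_filter, mem_univ, true_and] at hv
      rw [← hv]
    rw [Finset.sum_congr rfl h5, Finset.sum_const, nsmul_eq_mul]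
    gcongr
    refine le_trans ?_ (fiber_le b t.2)
    refine Finset.card_le_card_of_injOn (fun v => ((v⁻¹ : (ZMod q)ˣ) : ZMod q)) ?_ ?_
    · intro v hv
      simp only [coe_filter, mem_univ, true_and, Set.mem_ofPred_eq] at hv ⊢
      rw [← hv]
    · intro v _ w _ h
      simpa using Units.ext h
  have h2 := totient_div q
  have hq : (0:ℝ) < q := by exact_mod_cast NeZero.pos q
  have h3 : (q : ℝ) * ‖Kl q a b‖ ^ 4 ≤ q * (2 * (q : ℝ) ^ 3 * (#q.divisors : ℝ) ^ 3 * G b) := by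
    calc _ ≤ (#q.divisors * (q.totient : ℝ)) * ‖Kl q a b‖ ^ 4 := by gcongr
      _ = #q.divisors * ((q.totient : ℝ) * ‖Kl q a b‖ ^ 4) := by ring
      _ ≤ #q.divisors * (G b * (2 * (q : ℝ) ^ 4 * (#q.divisors : ℝ) ^ 2)) := by gcongr
      _ = _ := by ring
  exact le_of_mul_le_mul_left h3 hq
end C4

namespace C4
open Finset

lemma one_le_G {q : ℕ} [NeZero q] (b : ZMod q) : 1 ≤ G b := by
  unfold G
  exact Finset.card_pos.2 ⟨0, by simp⟩

lemma one_le_tau (q : ℕ) [NeZero q] : (1:ℝ) ≤ #q.divisors := by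
  exact_mod_cast Finset.card_pos.2 ⟨1, by simp [NeZero.ne q]⟩

lemma Kl_bound {q : ℕ} [NeZero q] (a b : ZMod q) :
    ‖Kl q a b‖ ≤ 2 * (q : ℝ) ^ (3/4 : ℝ) * (#q.divisors : ℝ) * G b := by
  have h := Kl_bound4 a b
  have hG : (1:ℝ) ≤ G b := by exact_mod_cast one_le_G b
  have ht := one_le_tau q
  have hq : (0:ℝ) ≤ q := by positivity
  refine le_of_pow_le_pow_left₀ (n := 4) (by norm_num) (by positivity) (h.trans ?_)
  have e : ((q : ℝ) ^ (3/4 : ℝ)) ^ 4 = (q:ℝ) ^ 3 := by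
    rw [← Real.rpow_natCast, ← Real.rpow_mul hq]; norm_num
  have : (2 * (q : ℝ) ^ (3/4 : ℝ) * (#q.divisors : ℝ) * G b) ^ 4 = 16 * (q:ℝ)^3 * (#q.divisors : ℝ)^4 * (G b:ℝ)^4 := by
    rw [mul_pow, mul_pow, mul_pow, e]; norm_num
  rw [this]
  have h1 : (#q.divisors : ℝ)^3 ≤ (#q.divisors : ℝ)^4 := pow_le_pow_right₀ ht (by norm_num)
  have h2 : (G b : ℝ) ≤ (G b : ℝ)^4 := by
    calc (G b : ℝ) = (G b:ℝ)^1 := by simp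
      _ ≤ _ := pow_le_pow_right₀ hG (by norm_num)
  gcongr
  norm_num

noncomputable def wt (q a : ℕ) : ℝ := (q : ℝ) / 2 * (1 / a + 1 / (q - a))

lemma sin_lb {t : ℝ} (h0 : 0 ≤ t) (h1 : t ≤ 1) : 2 * t * (1 - t) ≤ Real.sin (Real.pi * t) := by
  have hp := Real.pi_pos
  rcases le_total t (1/2) with h | h
  · have := Real.mul_le_sin (x := Real.pi * t) (by positivity) (by nlinarith)
    have e : 2 / Real.pi * (Real.pi * t) = 2 * t := by field_simp
    rw [e] at this
    nlinarith
  · have := Real.mul_le_sin (x := Real.pi * (1 - t)) (mul_nonneg hp.le (by linarith)) (by nlinarith)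
    have e : 2 / Real.pi * (Real.pi * (1-t)) = 2 * (1-t) := by field_simp
    have e2 : Real.sin (Real.pi * (1-t)) = Real.sin (Real.pi * t) := by
      rw [mul_sub, mul_one, Real.sin_pi_sub]
    rw [e, e2] at this
    nlinarith

lemma geo {q : ℕ} [NeZero q] (b : ZMod q) (hb : b ≠ 0) (A B : ℕ) :
    ‖∑ p ∈ Ico A B, ZMod.stdAddChar (b * (p : ZMod q))‖ ≤ wt q b.val := by
  have hq : (0:ℝ) < q := by exact_mod_cast NeZero.pos q
  have hb0 : (0:ℝ) < b.val := by
    have := ZMod.val_ne_zero b |>.2 hb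
    exact_mod_cast Nat.pos_of_ne_zero this
  have hbq : (b.val : ℝ) < q := by exact_mod_cast ZMod.val_lt b
  have hw : 0 < wt q b.val := by
    unfold wt
    have : 0 < (q:ℝ) - b.val := by linarith
    positivity
  rcases le_or_gt A B with hAB | hAB
  swap
  · rw [Finset.Ico_eq_empty (by omega)]; simpa using hw.le
  set z : ℂ := ZMod.stdAddChar b with hz
  have e : ∀ p : ℕ, ZMod.stdAddChar (b * (p : ZMod q)) = z ^ p := by
    intro p
    rw [hz, ← AddChar.map_nsmul_eq_pow, nsmul_eq_mul, mul_comm]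
  simp_rw [e]
  have hz1 : ‖z‖ = 1 := by simp [hz]
  have hlow : 4 * (b.val / q : ℝ) * (1 - b.val / q) ≤ ‖z - 1‖ := by
    have h1 : z = Complex.exp (Complex.I * ((2 * Real.pi * (b.val / q) : ℝ) : ℂ)) := by
      rw [hz]
      conv_lhs => rw [← ZMod.natCast_zmod_val b]
      have := ZMod.stdAddChar_coe (N := q) (b.val : ℤ)
      push_cast at this ⊢
      rw [this]
      congr 1; ring
    rw [h1, Complex.norm_exp_I_mul_ofReal_sub_one]
    have := sin_lb (t := b.val / q) (by positivity) (by rw [div_le_one hq]; exact hbq.le)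
    rw [Real.norm_eq_abs]
    refine le_trans ?_ (le_abs_self _)
    have e3 : 2 * Real.pi * ((b.val:ℝ) / q) / 2 = Real.pi * (b.val / q) := by ring
    rw [e3]; linarith
  have hpos : 0 < 4 * (b.val / q : ℝ) * (1 - b.val / q) := by
    have : (b.val / q : ℝ) < 1 := by rw [div_lt_one hq]; exact hbq
    have h2 : 0 < 1 - (b.val / q : ℝ) := by linarith
    positivity
  have hne : z ≠ 1 := by
    intro h
    rw [h, sub_self, norm_zero] at hlow
    linarith
  rw [geom_sum_Ico hne hAB, norm_div]
  have h2 : ‖z ^ B - z ^ A‖ ≤ 2 := by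
    refine (norm_sub_le _ _).trans ?_
    simp [hz1]; norm_num
  calc _ ≤ 2 / (4 * (b.val / q : ℝ) * (1 - b.val / q)) := by gcongr
    _ = wt q b.val := by
      unfold wt
      have : (q:ℝ) - b.val ≠ 0 := by linarith
      field_simp
      ring

lemma sum_zmod_val {q : ℕ} [NeZero q] (F : ℕ → ℝ) :
    ∑ a ∈ (univ : Finset (ZMod q)).erase 0, F a.val = ∑ a ∈ Ico 1 q, F a := by
  refine Finset.sum_bij (fun c _ => c.val) ?_ ?_ ?_ ?_
  · intro c hc
    have h1 := ZMod.val_lt c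
    have h2 : c.val ≠ 0 := by simpa using hc
    simp; omega
  · intro a _ b _ h; exact ZMod.val_injective q h
  · intro b hb
    simp at hb
    have : ((b : ℕ) : ZMod q).val = b := ZMod.val_cast_of_lt hb.2
    refine ⟨b, ?_, this⟩
    simp only [mem_erase, mem_univ, and_true]
    rw [← ZMod.val_ne_zero, this]; omega
  · intros; rfl

lemma sum_inv_le (q : ℕ) : ∑ a ∈ Ico 1 q, (1 / a : ℝ) ≤ 1 + Real.log q := by
  have h := harmonic_le_one_add_log q
  refine le_trans ?_ h
  rw [harmonic_eq_sum_Icc]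
  push_cast
  simp only [one_div]
  refine Finset.sum_le_sum_of_subset_of_nonneg ?_ (by intros; positivity)
  intro x; simp; omega

lemma sum_reflect' (q : ℕ) (F : ℕ → ℝ) : ∑ a ∈ Ico 1 q, F (q - a) = ∑ a ∈ Ico 1 q, F a := by
  refine Finset.sum_bij (fun a _ => q - a) ?_ ?_ ?_ ?_
  · intro a; simp; omega
  · intro a ha b hb; simp at ha hb ⊢; omega
  · intro b hb; simp at hb; exact ⟨q - b, by simp; omega, by omega⟩
  · intros; rfl

lemma sum_gcd_wt (q : ℕ) [NeZero q] : ∑ a ∈ Ico 1 q, (Nat.gcd a q : ℝ) * wt q a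
    ≤ q * (#q.divisors) * (1 + Real.log q) := by
  have h1 : ∑ a ∈ Ico 1 q, (Nat.gcd a q : ℝ) * wt q a = q * ∑ a ∈ Ico 1 q, (Nat.gcd a q : ℝ) * (1 / a) := by
    have : ∀ a ∈ Ico 1 q, (Nat.gcd a q : ℝ) * wt q a = q / 2 * ((Nat.gcd a q : ℝ) * (1 / a)) + q / 2 * ((fun a : ℕ => (Nat.gcd a q : ℝ) * (1 / a)) (q - a)) := by
      intro a ha
      simp at ha
      have : Nat.gcd (q - a) q = Nat.gcd a q := by
        rw [Nat.gcd_comm, Nat.gcd_comm a q]; exact Nat.gcd_self_sub_right ha.2.le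
      simp only [this]
      rw [Nat.cast_sub ha.2.le]
      unfold wt; ring
    rw [Finset.sum_congr rfl this, Finset.sum_add_distrib, ← Finset.mul_sum, ← Finset.mul_sum, sum_reflect' q (fun a : ℕ => (Nat.gcd a q : ℝ) * (1 / a))]
    ring
  rw [h1, mul_assoc]
  gcongr
  have h3 : ∀ c ∈ Ico 1 q, (Nat.gcd c q : ℝ) * (1 / c) ≤ ∑ d ∈ q.divisors, if d ∣ c then (d : ℝ) * (1 / c) else 0 := by
    intro c _
    have : Nat.gcd c q ∈ q.divisors := by simp [Nat.gcd_dvd_right, NeZero.ne q]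
    refine le_trans ?_ (Finset.single_le_sum (f := fun d : ℕ => if d ∣ c then (d : ℝ) * (1 / c) else 0) (by intros; positivity) this)
    simp [Nat.gcd_dvd_left]
  refine (Finset.sum_le_sum h3).trans ?_
  rw [Finset.sum_comm, ← nsmul_eq_mul]
  refine Finset.sum_le_card_nsmul _ _ _ ?_
  intro d hd
  have hd0 := Nat.pos_of_mem_divisors hd
  refine le_trans ?_ (sum_inv_le q)
  rw [← Finset.sum_filter]
  calc _ = ∑ c ∈ (Ico 1 q).filter (d ∣ ·), (1 / ((c / d : ℕ) : ℝ)) := by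
        refine Finset.sum_congr rfl fun c hc => ?_
        simp at hc
        obtain ⟨k, rfl⟩ := hc.2
        rw [Nat.mul_div_cancel_left _ hd0]
        push_cast
        have : (d:ℝ) ≠ 0 := by positivity
        field_simp
    _ = ∑ j ∈ ((Ico 1 q).filter (d ∣ ·)).image (· / d), (1 / (j : ℝ)) := by
        rw [Finset.sum_image]
        intro x hx y hy h
        simp at hx hy h
        obtain ⟨k, rfl⟩ := hx.2
        obtain ⟨l, rfl⟩ := hy.2
        rw [Nat.mul_div_cancel_left _ hd0, Nat.mul_div_cancel_left _ hd0] at h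
        rw [h]
    _ ≤ _ := by
        refine Finset.sum_le_sum_of_subset_of_nonneg ?_ (by intros; positivity)
        intro x hx
        simp at hx ⊢
        obtain ⟨c, ⟨⟨h1, h2⟩, ⟨k, rfl⟩⟩, rfl⟩ := hx
        rw [Nat.mul_div_cancel_left _ hd0]
        constructor
        · rcases Nat.eq_zero_or_pos k with h | h
          · simp [h] at h1
          · exact h
        · nlinarith

lemma sum_wt (q : ℕ) : ∑ a ∈ Ico 1 q, wt q a ≤ q * (1 + Real.log q) := by
  have h1 : ∑ a ∈ Ico 1 q, wt q a = q * ∑ a ∈ Ico 1 q, (1 / a : ℝ) := by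
    have : ∀ a ∈ Ico 1 q, wt q a = q / 2 * (1 / a : ℝ) + q / 2 * ((fun a : ℕ => (1 / a : ℝ)) (q - a)) := by
      intro a ha
      simp at ha
      simp only []
      rw [Nat.cast_sub ha.2.le]
      unfold wt; ring
    rw [Finset.sum_congr rfl this, Finset.sum_add_distrib, ← Finset.mul_sum, ← Finset.mul_sum, sum_reflect' q (fun a : ℕ => (1 / a : ℝ))]
    ring
  rw [h1]
  gcongr
  exact sum_inv_le q
end C4

namespace C4
open Finset

lemma fourier_id {q : ℕ} [NeZero q] (A B M : ℕ) :
    (q : ℂ) ^ 2 * ∑ u : (ZMod q)ˣ, (∑ p ∈ Ico A B, if (p : ZMod q) = u then (1 : ℂ) else 0) *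
        (∑ m ∈ Ico 0 M, if (m : ZMod q) = - ((u⁻¹ : (ZMod q)ˣ) : ZMod q) then (1 : ℂ) else 0)
      = ∑ b : ZMod q, ∑ a : ZMod q, (∑ p ∈ Ico A B, ZMod.stdAddChar (-a * (p : ZMod q))) *
          (∑ m ∈ Ico 0 M, ZMod.stdAddChar (b * (m : ZMod q))) * Kl q a b := by
  have h1 : ∀ u : (ZMod q)ˣ, (q : ℂ) * (∑ p ∈ Ico A B, if (p : ZMod q) = u then (1 : ℂ) else 0)
      = ∑ a : ZMod q, (∑ p ∈ Ico A B, ZMod.stdAddChar (-a * (p : ZMod q))) * ZMod.stdAddChar (a * (u : ZMod q)) := by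
    intro u
    simp_rw [Finset.sum_mul]
    rw [Finset.sum_comm, Finset.mul_sum]
    refine Finset.sum_congr rfl fun p _ => ?_
    have := orth (q := q) ((u : ZMod q) - p)
    simp only [sub_eq_zero] at this
    rw [mul_ite, mul_one, mul_zero]
    simp_rw [eq_comm (a := (p : ZMod q))]
    rw [← this]
    refine Finset.sum_congr rfl fun a _ => ?_
    rw [← AddChar.map_add_eq_mul]
    congr 1; ring
  have h2 : ∀ u : (ZMod q)ˣ, (q : ℂ) * (∑ m ∈ Ico 0 M, if (m : ZMod q) = - ((u⁻¹ : (ZMod q)ˣ) : ZMod q) then (1 : ℂ) else 0)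
      = ∑ b : ZMod q, (∑ m ∈ Ico 0 M, ZMod.stdAddChar (b * (m : ZMod q))) * ZMod.stdAddChar (b * ((u⁻¹ : (ZMod q)ˣ) : ZMod q)) := by
    intro u
    simp_rw [Finset.sum_mul]
    rw [Finset.sum_comm, Finset.mul_sum]
    refine Finset.sum_congr rfl fun p _ => ?_
    have := orth (q := q) ((p : ZMod q) + ((u⁻¹ : (ZMod q)ˣ) : ZMod q))
    simp only [add_eq_zero_iff_eq_neg] at this
    rw [mul_ite, mul_one, mul_zero]
    rw [← this]
    refine Finset.sum_congr rfl fun a _ => ?_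
    rw [← AddChar.map_add_eq_mul]
    congr 1; ring
  have h3 : ∀ u : (ZMod q)ˣ, (q : ℂ) ^ 2 * ((∑ p ∈ Ico A B, if (p : ZMod q) = u then (1 : ℂ) else 0) *
        (∑ m ∈ Ico 0 M, if (m : ZMod q) = - ((u⁻¹ : (ZMod q)ˣ) : ZMod q) then (1 : ℂ) else 0)) =
      ∑ b : ZMod q, ∑ a : ZMod q, (∑ p ∈ Ico A B, ZMod.stdAddChar (-a * (p : ZMod q))) *
          (∑ m ∈ Ico 0 M, ZMod.stdAddChar (b * (m : ZMod q))) * ZMod.stdAddChar (a * (u : ZMod q) + b * ((u⁻¹ : (ZMod q)ˣ) : ZMod q)) := by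
    intro u
    rw [sq, mul_mul_mul_comm, h1, h2, Finset.sum_mul_sum, Finset.sum_comm]
    refine Finset.sum_congr rfl fun b _ => Finset.sum_congr rfl fun a _ => ?_
    rw [AddChar.map_add_eq_mul]; ring
  rw [Finset.mul_sum]
  simp_rw [h3, Kl, Finset.mul_sum]
  rw [Finset.sum_comm]
  refine Finset.sum_congr rfl fun b _ => ?_
  rw [Finset.sum_comm]

lemma fourier_id0 {q : ℕ} [NeZero q] (A B : ℕ) :
    (q : ℂ) * ∑ u : (ZMod q)ˣ, (∑ p ∈ Ico A B, if (p : ZMod q) = u then (1 : ℂ) else 0)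
      = ∑ a : ZMod q, (∑ p ∈ Ico A B, ZMod.stdAddChar (-a * (p : ZMod q))) * Kl q a 0 := by
  have h1 : ∀ u : (ZMod q)ˣ, (q : ℂ) * (∑ p ∈ Ico A B, if (p : ZMod q) = u then (1 : ℂ) else 0)
      = ∑ a : ZMod q, (∑ p ∈ Ico A B, ZMod.stdAddChar (-a * (p : ZMod q))) * ZMod.stdAddChar (a * (u : ZMod q)) := by
    intro u
    simp_rw [Finset.sum_mul]
    rw [Finset.sum_comm, Finset.mul_sum]
    refine Finset.sum_congr rfl fun p _ => ?_
    have := orth (q := q) ((u : ZMod q) - p)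
    simp only [sub_eq_zero] at this
    rw [mul_ite, mul_one, mul_zero]
    simp_rw [eq_comm (a := (p : ZMod q))]
    rw [← this]
    refine Finset.sum_congr rfl fun a _ => ?_
    rw [← AddChar.map_add_eq_mul]
    congr 1; ring
  rw [Finset.mul_sum]
  simp_rw [h1, Kl, Finset.mul_sum]
  rw [Finset.sum_comm]
  simp

lemma wt_neg {q : ℕ} [NeZero q] (a : ZMod q) (ha : a ≠ 0) : wt q (-a).val = wt q a.val := by
  have : NeZero a := ⟨ha⟩
  rw [ZMod.val_neg_of_ne_zero]
  unfold wt
  rw [Nat.cast_sub (ZMod.val_lt a).le]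
  ring

lemma equi_complex {q : ℕ} [NeZero q] (A B M : ℕ) (hAB : A ≤ B) :
    ‖(∑ u : (ZMod q)ˣ, (∑ p ∈ Ico A B, if (p : ZMod q) = u then (1 : ℂ) else 0) *
        (∑ m ∈ Ico 0 M, if (m : ZMod q) = - ((u⁻¹ : (ZMod q)ˣ) : ZMod q) then (1 : ℂ) else 0))
      - (M / q : ℂ) * ∑ u : (ZMod q)ˣ, (∑ p ∈ Ico A B, if (p : ZMod q) = u then (1 : ℂ) else 0)‖
    ≤ 2 * (((B : ℝ) - A) / q + (1 + Real.log q)) * (q : ℝ) ^ (3/4 : ℝ) * (#q.divisors : ℝ) ^ 2 * (1 + Real.log q) := by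
  have hq : (0:ℝ) < q := by exact_mod_cast NeZero.pos q
  have hqc : (q:ℂ) ≠ 0 := by exact_mod_cast (NeZero.ne q)
  set LHS := (∑ u : (ZMod q)ˣ, (∑ p ∈ Ico A B, if (p : ZMod q) = u then (1 : ℂ) else 0) *
        (∑ m ∈ Ico 0 M, if (m : ZMod q) = - ((u⁻¹ : (ZMod q)ˣ) : ZMod q) then (1 : ℂ) else 0))
      - (M / q : ℂ) * ∑ u : (ZMod q)ˣ, (∑ p ∈ Ico A B, if (p : ZMod q) = u then (1 : ℂ) else 0) with hL
  have e : (q : ℂ) ^ 2 * LHS = ∑ b ∈ (univ : Finset (ZMod q)).erase 0, ∑ a : ZMod q, (∑ p ∈ Ico A B, ZMod.stdAddChar (-a * (p : ZMod q))) *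
          (∑ m ∈ Ico 0 M, ZMod.stdAddChar (b * (m : ZMod q))) * Kl q a b := by
    rw [hL, mul_sub, fourier_id]
    have : (q : ℂ) ^ 2 * ((M / q : ℂ) * ∑ u : (ZMod q)ˣ, (∑ p ∈ Ico A B, if (p : ZMod q) = u then (1 : ℂ) else 0))
      = M * (q * ∑ u : (ZMod q)ˣ, (∑ p ∈ Ico A B, if (p : ZMod q) = u then (1 : ℂ) else 0)) := by
      field_simp
    rw [this, fourier_id0, ← Finset.add_sum_erase _ _ (mem_univ (0 : ZMod q)), Finset.mul_sum]
    rw [add_comm, add_sub_assoc]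
    convert add_zero _ using 2
    rw [sub_eq_zero]
    refine Finset.sum_congr rfl fun a _ => ?_
    simp
    ring
  have hlog : 0 ≤ Real.log q := Real.log_natCast_nonneg q
  set K : ℝ := 2 * (q : ℝ) ^ (3/4 : ℝ) * (#q.divisors : ℝ) with hK
  have hK0 : 0 ≤ K := by positivity
  have hC : ∑ a : ZMod q, ‖∑ p ∈ Ico A B, ZMod.stdAddChar (-a * (p : ZMod q))‖ ≤ ((B:ℝ) - A) + q * (1 + Real.log q) := by
    rw [← Finset.add_sum_erase _ _ (mem_univ (0 : ZMod q))]
    refine add_le_add ?_ ?_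
    · simp [Nat.cast_sub hAB]
      rw [← Nat.cast_sub hAB, Complex.norm_natCast, Nat.cast_sub hAB]
    · refine le_trans ?_ (sum_wt q)
      rw [← sum_zmod_val]
      refine Finset.sum_le_sum fun a ha => ?_
      have ha' : a ≠ 0 := by simpa using ha
      rw [← wt_neg a ha']
      exact geo (-a) (by simpa using ha') A B
  have hb : (q : ℝ) ^ 2 * ‖LHS‖ ≤ (((B:ℝ) - A) + q * (1 + Real.log q)) * K * (q * (#q.divisors) * (1 + Real.log q)) := by
    have : (q : ℝ) ^ 2 * ‖LHS‖ = ‖(q : ℂ) ^ 2 * LHS‖ := by simp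
    rw [this, e]
    refine (norm_sum_le _ _).trans ?_
    refine le_trans ?_ (mul_le_mul_of_nonneg_left (sum_gcd_wt q) ?_)
    · rw [← sum_zmod_val (q := q) (fun a => (Nat.gcd a q : ℝ) * wt q a), Finset.mul_sum]
      refine Finset.sum_le_sum fun b hb => ?_
      have hb' : b ≠ 0 := by simpa using hb
      have hg := geo b hb' 0 M
      have hw : 0 ≤ wt q b.val := (norm_nonneg _).trans hg
      refine (norm_sum_le _ _).trans ?_
      have hG : (G b : ℝ) ≤ Nat.gcd b.val q := by
        have := G_le_gcd (q := q) b.val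
        rw [ZMod.natCast_zmod_val] at this
        exact_mod_cast this
      calc _ ≤ ∑ a : ZMod q, ‖∑ p ∈ Ico A B, ZMod.stdAddChar (-a * (p : ZMod q))‖ * (wt q b.val * (K * Nat.gcd b.val q)) := by
            refine Finset.sum_le_sum fun a _ => ?_
            rw [norm_mul, norm_mul, mul_assoc]
            have h5 : ‖Kl q a b‖ ≤ K * Nat.gcd b.val q := (Kl_bound a b).trans (by gcongr)
            gcongr
        _ = (∑ a : ZMod q, ‖∑ p ∈ Ico A B, ZMod.stdAddChar (-a * (p : ZMod q))‖) * (wt q b.val * (K * Nat.gcd b.val q)) := by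
            rw [Finset.sum_mul]
        _ ≤ (((B:ℝ) - A) + q * (1 + Real.log q)) * (wt q b.val * (K * Nat.gcd b.val q)) := by gcongr
        _ = _ := by ring
    · have : (A:ℝ) ≤ B := by exact_mod_cast hAB
      have h2 : 0 ≤ (B:ℝ) - A := by linarith
      positivity
  have : (q:ℝ)^2 * (2 * (((B : ℝ) - A) / q + (1 + Real.log q)) * (q : ℝ) ^ (3/4 : ℝ) * (#q.divisors : ℝ) ^ 2 * (1 + Real.log q)) = (((B:ℝ) - A) + q * (1 + Real.log q)) * K * (q * (#q.divisors) * (1 + Real.log q)) := by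
    rw [hK]; field_simp
  rw [← this] at hb
  exact le_of_mul_le_mul_left hb (by positivity)

/-- real counting form -/
lemma equi (q : ℕ) (hq0 : 1 ≤ q) (A B M : ℕ) (hAB : A ≤ B) (hM : M ≤ q) :
    |(#{p ∈ Ico A B | Nat.Coprime p q ∧ (-((p : ZMod q)⁻¹)).val < M} : ℝ)
      - (M / q : ℝ) * #{p ∈ Ico A B | Nat.Coprime p q}|
    ≤ 2 * (((B : ℝ) - A) / q + (1 + Real.log q)) * (q : ℝ) ^ (3/4 : ℝ) * (#q.divisors : ℝ) ^ 2 * (1 + Real.log q) := by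
  have : NeZero q := ⟨by omega⟩
  have h := equi_complex (q := q) A B M hAB
  have e1 : ∀ u : (ZMod q)ˣ, (∑ m ∈ Ico 0 M, if (m : ZMod q) = - ((u⁻¹ : (ZMod q)ˣ) : ZMod q) then (1 : ℂ) else 0)
     = if (- ((u⁻¹ : (ZMod q)ˣ) : ZMod q)).val < M then 1 else 0 := by
    intro u
    set t := (- ((u⁻¹ : (ZMod q)ˣ) : ZMod q)) with ht
    have : ∀ m ∈ Ico 0 M, (if (m : ZMod q) = t then (1 : ℂ) else 0) = if t.val = m then 1 else 0 := by
      intro m hm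
      simp at hm
      have h1 : ((m : ℕ) : ZMod q).val = m := ZMod.val_cast_of_lt (by omega)
      have : (m : ZMod q) = t ↔ t.val = m := by
        constructor
        · intro h; rw [← h, h1]
        · intro h; rw [← h, ZMod.natCast_zmod_val]
      simp only [this]
    rw [Finset.sum_congr rfl this, Finset.sum_ite_eq]
    simp
  have key : ∀ F : ZMod q → ℂ, ∑ u : (ZMod q)ˣ, (∑ p ∈ Ico A B, if (p : ZMod q) = u then (1 : ℂ) else 0) * F ((u⁻¹ : (ZMod q)ˣ) : ZMod q)
      = ∑ p ∈ Ico A B, if Nat.Coprime p q then F ((p : ZMod q)⁻¹) else 0 := by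
    intro F
    simp_rw [Finset.sum_mul]
    rw [Finset.sum_comm]
    refine Finset.sum_congr rfl fun p _ => ?_
    split_ifs with hp
    · rw [Finset.sum_eq_single (ZMod.unitOfCoprime p hp)]
      · rw [← ZMod.inv_coe_unit]; simp
      · intro u _ hu
        rw [if_neg, zero_mul]
        intro h
        apply hu
        ext
        simp [← h]
      · simp
    · refine Finset.sum_eq_zero fun u _ => ?_
      rw [if_neg, zero_mul]
      intro h
      apply hp
      rw [← ZMod.isUnit_iff_coprime, h]
      exact u.isUnit
  simp_rw [e1] at h
  rw [key (fun x => if (-x).val < M then 1 else 0)] at h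
  have k2 := key (fun _ => 1)
  simp only [mul_one] at k2
  rw [k2] at h
  refine le_trans (le_of_eq ?_) h
  rw [← Real.norm_eq_abs, ← Complex.norm_real]
  congr 1
  push_cast
  congr 1
  · rw [Finset.card_filter]
    push_cast
    refine Finset.sum_congr rfl fun p _ => ?_
    split_ifs <;> simp_all
  · rw [Finset.card_filter]
    push_cast
    rfl
end C4

namespace C4
open Finset

lemma div_bound (ε : ℝ) (hε : 0 < ε) : ∃ C : ℝ, 1 ≤ C ∧ ∀ n : ℕ, 1 ≤ n → (#n.divisors : ℝ) ≤ C * (n : ℝ) ^ ε := by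
  obtain ⟨B, hB⟩ := exists_nat_ge ((2:ℝ) ^ (1/ε))
  have hl2 : 0 < Real.log 2 := Real.log_pos (by norm_num)
  set K : ℝ := 1 + 1 / (ε * Real.log 2) with hK
  have hK1 : 1 ≤ K := by
    have : 0 < 1 / (ε * Real.log 2) := by positivity
    linarith
  have hsmall : ∀ e : ℕ, ∀ p : ℕ, 2 ≤ p → ((e : ℝ) + 1) ≤ K * ((p : ℝ) ^ e) ^ ε := by
    intro e p hp
    have hp' : (2:ℝ) ≤ p := by exact_mod_cast hp
    have h1 : ((2:ℝ) ^ e) ^ ε ≤ ((p : ℝ) ^ e) ^ ε := by gcongr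
    have h2 : 1 + e * (ε * Real.log 2) ≤ ((2:ℝ) ^ e) ^ ε := by
      have : ((2:ℝ) ^ e) ^ ε = Real.exp (e * (ε * Real.log 2)) := by
        rw [Real.rpow_def_of_pos (by positivity), Real.log_pow]; congr 1; ring
      rw [this]
      have := Real.add_one_le_exp (e * (ε * Real.log 2))
      linarith
    have h3 : (e : ℝ) + 1 ≤ K * (1 + e * (ε * Real.log 2)) := by
      rw [hK]
      have : (1 + 1 / (ε * Real.log 2)) * (1 + e * (ε * Real.log 2)) = 1 + e + e * (ε * Real.log 2) + 1 / (ε * Real.log 2) := by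
        field_simp; ring
      rw [this]
      have : 0 < 1 / (ε * Real.log 2) := by positivity
      have : 0 ≤ e * (ε * Real.log 2) := by positivity
      linarith
    calc _ ≤ _ := h3
      _ ≤ _ := by gcongr; exact h2.trans h1
  have hbig : ∀ e : ℕ, ∀ p : ℕ, B ≤ p → ((e : ℝ) + 1) ≤ ((p : ℝ) ^ e) ^ ε := by
    intro e p hp
    have hp' : (2:ℝ) ^ (1/ε) ≤ p := hB.trans (by exact_mod_cast hp)
    have h1 : (2:ℝ) ≤ (p:ℝ) ^ ε := by
      calc (2:ℝ) = ((2:ℝ) ^ (1/ε)) ^ ε := by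
            rw [← Real.rpow_mul (by norm_num)]; field_simp; simp
        _ ≤ _ := by gcongr
    have h2 : ((p : ℝ) ^ e) ^ ε = ((p:ℝ) ^ ε) ^ e := by
      rw [← Real.rpow_natCast, ← Real.rpow_natCast, ← Real.rpow_mul (by positivity), ← Real.rpow_mul (by positivity), mul_comm]
    rw [h2]
    have h3 : (e : ℝ) + 1 ≤ 2 ^ e := by
      have : e < 2 ^ e := Nat.lt_two_pow_self
      exact_mod_cast this
    exact h3.trans (by gcongr)
  have main : ∀ n : ℕ, 1 ≤ n → (#n.divisors : ℝ) ≤ K ^ (#(n.primeFactors ∩ range B)) * (n : ℝ) ^ ε := by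
    intro n
    induction n using Nat.recOnPosPrimePosCoprime with
    | zero => simp
    | one => simp
    | prime_pow p e hp he =>
      intro _
      rw [Nat.divisors_prime_pow hp, Finset.card_map, Finset.card_range, Nat.primeFactors_prime_pow he.ne' hp]
      push_cast
      by_cases h : p < B
      · have : ({p} : Finset ℕ) ∩ range B = {p} := by
          ext x; simp; intro h; rwa [h]
        rw [this]
        simpa using hsmall e p hp.two_le
      · have : ({p} : Finset ℕ) ∩ range B = ∅ := by
          ext x; simp; intro h; omega
        rw [this]
        simpa using hbig e p (by omega)
    | coprime a b ha hb hab iha ihb =>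
      intro _
      rw [hab.card_divisors_mul, hab.primeFactors_mul, Finset.union_inter_distrib_right,
        Finset.card_union_of_disjoint, pow_add]
      · push_cast
        rw [Real.mul_rpow (by positivity) (by positivity)]
        calc _ ≤ (K ^ #(a.primeFactors ∩ range B) * (a:ℝ) ^ ε) * (K ^ #(b.primeFactors ∩ range B) * (b:ℝ) ^ ε) := by
              gcongr
              · exact iha (by omega)
              · exact ihb (by omega)
          _ = _ := by ring
      · exact Disjoint.mono Finset.inter_subset_left Finset.inter_subset_left hab.disjoint_primeFactors
  refine ⟨K ^ B, one_le_pow₀ hK1, fun n hn => (main n hn).trans ?_⟩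
  gcongr
  refine (Finset.card_le_card Finset.inter_subset_right).trans (by simp)

/-- log bound -/
lemma log_bound (ε : ℝ) (hε : 0 < ε) : ∃ C : ℝ, 1 ≤ C ∧ ∀ x : ℝ, 1 ≤ x → 1 + Real.log x ≤ C * x ^ ε := by
  refine ⟨1 + 1/ε, by have : 0 < 1/ε := by positivity
                      linarith, fun x hx => ?_⟩
  have h1 := Real.log_le_rpow_div (x := x) (by linarith) hε
  have h2 : (1:ℝ) ≤ x ^ ε := Real.one_le_rpow hx hε.le
  have : (1 + 1/ε) * x ^ ε = x ^ ε + x ^ ε / ε := by ring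
  linarith

/-- final equidistribution bound -/
lemma equi' : ∃ C : ℝ, 1 ≤ C ∧ ∀ (q : ℕ) (_ : 1 ≤ q) (A B M : ℕ) (_ : A ≤ B) (_ : M ≤ q),
    |(#{p ∈ Ico A B | Nat.Coprime p q ∧ (-((p : ZMod q)⁻¹)).val < M} : ℝ)
      - (M / q : ℝ) * #{p ∈ Ico A B | Nat.Coprime p q}|
    ≤ C * (((B : ℝ) - A) / q + 1) * (q : ℝ) ^ (7/8 : ℝ) := by
  obtain ⟨C1, hC1, h1⟩ := div_bound (1/32) (by norm_num)
  obtain ⟨C2, hC2, h2⟩ := log_bound (1/32) (by norm_num)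
  refine ⟨2 * C1 ^ 2 * C2 ^ 2, ?_, ?_⟩
  · have : 1 ≤ C1 ^ 2 := one_le_pow₀ hC1
    have : 1 ≤ C2 ^ 2 := one_le_pow₀ hC2
    nlinarith
  intro q hq A B M hAB hM
  refine (equi q hq A B M hAB hM).trans ?_
  have hq' : (1:ℝ) ≤ q := by exact_mod_cast hq
  have hq0 : (0:ℝ) < q := by linarith
  have hL : 0 ≤ Real.log q := Real.log_nonneg hq'
  have hBA : 0 ≤ ((B:ℝ) - A) / q := by
    have : (A:ℝ) ≤ B := by exact_mod_cast hAB
    exact div_nonneg (by linarith) hq0.le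
  set X := (q:ℝ) ^ (1/32 : ℝ) with hX
  have e : (q:ℝ) ^ (7/8 : ℝ) = (q:ℝ) ^ (3/4:ℝ) * X ^ 4 := by
    rw [hX, ← Real.rpow_natCast, ← Real.rpow_mul hq0.le, ← Real.rpow_add hq0]; norm_num
  rw [e]
  calc _ ≤ 2 * ((((B:ℝ) - A) / q + 1) * (1 + Real.log q)) * (q:ℝ) ^ (3/4:ℝ) * (C1 * X) ^ 2 * (C2 * X) := by
        gcongr
        · nlinarith
        · exact h1 q hq
        · exact h2 q hq'
    _ ≤ 2 * ((((B:ℝ) - A) / q + 1) * (C2 * X)) * (q:ℝ) ^ (3/4:ℝ) * (C1 * X) ^ 2 * (C2 * X) := by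
        gcongr
        exact h2 q hq'
    _ = _ := by ring
end C4

namespace C4
open Finset

lemma modInv_eq (p q : ℕ) (hq : 1 ≤ q) (hqp : q < p) (h : Nat.Coprime p q) :
    q * modInv p q = 1 + p * (-((p : ZMod q)⁻¹)).val := by
  have : NeZero p := ⟨by omega⟩
  have : NeZero q := ⟨by omega⟩
  have : Fact (1 < p) := ⟨by omega⟩
  set m := (-((p : ZMod q)⁻¹)).val with hm
  have hmq : m < q := ZMod.val_lt _
  set r := modInv p q with hr
  have hinv : (q : ZMod p) * (q : ZMod p)⁻¹ = 1 := ZMod.coe_mul_inv_eq_one q h.symm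
  have hinv2 : (p : ZMod q) * (p : ZMod q)⁻¹ = 1 := ZMod.coe_mul_inv_eq_one p h
  have hne : ((q : ZMod p)⁻¹).val ≠ 0 := by
    intro h0
    rw [ZMod.val_eq_zero] at h0
    rw [h0, mul_zero] at hinv
    exact zero_ne_one hinv
  have hr' : r = ((q : ZMod p)⁻¹).val := by rw [hr, modInv, if_neg hne]
  have hr1 : 1 ≤ r := by omega
  have hrp : r < p := by rw [hr']; exact ZMod.val_lt _
  have d1 : (p : ℤ) ∣ (q * r - (1 + p * m) : ℤ) := by
    rw [← ZMod.intCast_zmod_eq_zero_iff_dvd]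
    push_cast
    rw [hr', ZMod.natCast_zmod_val, hinv]; simp
  have d2 : (q : ℤ) ∣ (q * r - (1 + p * m) : ℤ) := by
    rw [← ZMod.intCast_zmod_eq_zero_iff_dvd]
    push_cast
    rw [hm, ZMod.natCast_zmod_val]; simp [hinv2]
  have d3 : ((p:ℤ) * q) ∣ (q * r - (1 + p * m) : ℤ) :=
    IsCoprime.mul_dvd (Nat.isCoprime_iff_coprime.2 h) d1 d2
  have hz : (q * r - (1 + p * m) : ℤ) = 0 := by
    apply Int.eq_zero_of_abs_lt_dvd d3
    have a1 : (1:ℤ) ≤ r := by exact_mod_cast hr1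
    have a2 : (r:ℤ) < p := by exact_mod_cast hrp
    have a3 : (m:ℤ) + 1 ≤ q := by exact_mod_cast hmq
    have a4 : (0:ℤ) ≤ m := by positivity
    have a5 : (1:ℤ) ≤ q := by exact_mod_cast hq
    have a6 : (1:ℤ) ≤ p := by omega
    rw [abs_lt]
    constructor <;> nlinarith
  have : ((q * r : ℕ) : ℤ) = ((1 + p * m : ℕ) : ℤ) := by push_cast; linarith
  exact_mod_cast this

/-- the fibre conditions -/
def Base (N X n k q p : ℕ) : Prop :=
  Nat.Coprime p q ∧ q < p ∧ N < p ∧ n * q + k * p ≤ X ∧ k < n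

instance (N X n k q p : ℕ) : Decidable (Base N X n k q p) := by unfold Base; infer_instance

lemma fibre_bound : ∃ C : ℝ, 1 ≤ C ∧ ∀ (α : ℝ) (_ : 0 < α) (_ : α ≤ 1) (N X n k q : ℕ)
    (_ : 1 ≤ q) (_ : 1 ≤ k) (_ : 1 ≤ n),
    |(({p ∈ Icc 1 X | Base N X n k q p ∧ (modInv p q : ℝ) ≤ α * p}.card : ℕ) : ℝ)
      - α * ({p ∈ Icc 1 X | Base N X n k q p}.card : ℕ)|
    ≤ if n * q ≤ X then C * (X / k) * (q : ℝ) ^ (-(1/8) : ℝ) else 0 := by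
  obtain ⟨C, hC, hE⟩ := equi'
  refine ⟨3 * C, by linarith, ?_⟩
  intro α hα0 hα1 N X n k q hq hk hn
  set A := max N q + 1 with hA
  set B := (X - n * q) / k + 1 with hB
  by_cases hcase : n * q ≤ X ∧ k < n ∧ A < B
  swap
  · have e : ∀ p ∈ Icc 1 X, ¬ Base N X n k q p := by
      intro p _ hb
      obtain ⟨h1, h2, h3, h4, h5⟩ := hb
      apply hcase
      refine ⟨by omega, h5, ?_⟩
      have : p ≤ (X - n * q) / k := by
        rw [Nat.le_div_iff_mul_le (by omega)]
        rw [mul_comm]; omega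
      omega
    rw [Finset.filter_false_of_mem (by intro p hp h; exact e p hp h.1), Finset.filter_false_of_mem e]
    simp
    split_ifs <;> positivity
  obtain ⟨h1, h2, h3⟩ := hcase
  rw [if_pos h1]
  have hbase : ∀ p, (p ∈ Icc 1 X ∧ Base N X n k q p) ↔ (p ∈ Ico A B ∧ Nat.Coprime p q) := by
    intro p
    have hdiv : p < B ↔ n * q + k * p ≤ X := by
      rw [hB, Nat.lt_succ_iff, Nat.le_div_iff_mul_le (by omega), mul_comm]; omega
    simp only [mem_Icc, mem_Ico, Base, hdiv]
    constructor
    · rintro ⟨_, a, b, c, d, _⟩; exact ⟨⟨by omega, d⟩, a⟩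
    · rintro ⟨⟨a, b⟩, c⟩
      have : p ≤ k * p := Nat.le_mul_of_pos_left p hk
      exact ⟨⟨by omega, by omega⟩, c, by omega, by omega, b, h2⟩
  have hq0 : (0:ℝ) < q := by exact_mod_cast hq
  have hk0 : (0:ℝ) < k := by exact_mod_cast hk
  set b : ℝ := ((({p ∈ Icc 1 X | Base N X n k q p} : Finset ℕ).card : ℕ) : ℝ) with hb
  have eb : b = #{p ∈ Ico A B | Nat.Coprime p q} := by
    rw [hb]; congr 2; ext p; simpa only [mem_filter] using hbase p
  have hBA : ((B:ℝ) - A) ≤ X / k := by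
    have h5 : B - 1 ≤ X / k := by rw [hB]; simp; exact Nat.div_le_div_right (by omega)
    have h6 : ((X / k : ℕ) : ℝ) ≤ X / k := Nat.cast_div_le
    have h7 : ((B - 1 : ℕ):ℝ) ≤ ((X / k : ℕ) : ℝ) := by exact_mod_cast h5
    have h8 : 1 ≤ B := by omega
    rw [Nat.cast_sub h8] at h7
    have h9 : (1:ℝ) ≤ A := by rw [hA]; push_cast; have : (0:ℝ) ≤ max (N:ℝ) q := le_max_of_le_right hq0.le
                              linarith
    push_cast at h7; linarith
  have hBA0 : 0 ≤ (B:ℝ) - A := by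
    have : (A:ℝ) ≤ B := by exact_mod_cast h3.le
    linarith
  have hone : (1:ℝ) ≤ X / k / q := by
    have h5 : q ≤ (X - n * q) / k := by omega
    rw [Nat.le_div_iff_mul_le (by omega)] at h5
    have h6 : q * k ≤ X := by omega
    rw [div_div, le_div_iff₀ (by positivity), one_mul]
    have : ((q * k : ℕ) : ℝ) ≤ X := by exact_mod_cast h6
    push_cast at this; linarith
  have hble : b ≤ (B:ℝ) - A := by
    rw [eb, ← Nat.cast_sub h3.le]
    have := Finset.card_filter_le (Ico A B) (fun p => Nat.Coprime p q)
    rw [Nat.card_Ico] at this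
    exact_mod_cast this
  set E : ℝ := C * (((B : ℝ) - A) / q + 1) * (q : ℝ) ^ (7/8 : ℝ) with hEdef
  have hq78 : (1:ℝ) ≤ (q:ℝ) ^ (7/8:ℝ) := Real.one_le_rpow (by exact_mod_cast hq) (by norm_num)
  set M := ⌊α * q⌋₊ with hM
  have hMle : (M:ℝ) ≤ α * q := Nat.floor_le (by positivity)
  have hMlt : α * q < M + 1 := Nat.lt_floor_add_one _
  have hMq : M ≤ q := by
    have : (M:ℝ) ≤ q := by nlinarith
    exact_mod_cast this
  set a : ℝ := (({p ∈ Icc 1 X | Base N X n k q p ∧ (modInv p q : ℝ) ≤ α * p}.card : ℕ) : ℝ) with ha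
  have hcond : ∀ p, Base N X n k q p → ((modInv p q : ℝ) ≤ α * p ↔ 1 + (p:ℝ) * (-((p : ZMod q)⁻¹)).val ≤ α * p * q) := by
    intro p hp
    have := modInv_eq p q hq hp.2.1 hp.1
    have h5 : (q:ℝ) * modInv p q = 1 + p * (-((p : ZMod q)⁻¹)).val := by exact_mod_cast this
    rw [← h5]
    constructor
    · intro h; nlinarith
    · intro h
      have : (q:ℝ) * modInv p q ≤ q * (α * p) := by linarith
      exact le_of_mul_le_mul_left this hq0
  have hlow : (#{p ∈ Ico A B | Nat.Coprime p q ∧ (-((p : ZMod q)⁻¹)).val < M} : ℝ) ≤ a := by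
    rw [ha]
    norm_cast
    refine Finset.card_le_card ?_
    intro p hp
    simp only [mem_filter] at hp ⊢
    have hp2 := (hbase p).2 ⟨hp.1, hp.2.1⟩
    refine ⟨hp2.1, hp2.2, (hcond p hp2.2).2 ?_⟩
    have h5 : ((-((p : ZMod q)⁻¹)).val : ℝ) + 1 ≤ M := by exact_mod_cast hp.2.2
    have h6 : (1:ℝ) ≤ p := by
      have := (mem_Icc.1 hp2.1).1
      exact_mod_cast this
    nlinarith
  have hupp : a ≤ (#{p ∈ Ico A B | Nat.Coprime p q ∧ (-((p : ZMod q)⁻¹)).val < min (M+1) q} : ℝ) := by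
    rw [ha]
    norm_cast
    refine Finset.card_le_card ?_
    intro p hp
    simp only [mem_filter] at hp ⊢
    have hp2 := (hbase p).1 ⟨hp.1, hp.2.1⟩
    refine ⟨hp2.1, hp2.2, ?_⟩
    have h4 := (hcond p hp.2.1).1 hp.2.2
    have h6 : (1:ℝ) ≤ p := by
      have := (mem_Icc.1 hp.1).1
      exact_mod_cast this
    have : NeZero q := ⟨by omega⟩
    rw [lt_min_iff]
    refine ⟨?_, ZMod.val_lt _⟩
    have h7 : ((-((p : ZMod q)⁻¹)).val : ℝ) < M + 1 := by
      by_contra hcon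
      push Not at hcon
      nlinarith
    exact_mod_cast h7
  have E1 := hE q hq A B M h3.le hMq
  have E2 := hE q hq A B (min (M+1) q) h3.le (min_le_right _ _)
  rw [← eb, ← hEdef] at E1 E2
  rw [abs_le] at E1 E2
  have hb0 : 0 ≤ b := by rw [hb]; positivity
  have m1 : α * b - b / q ≤ (M / q : ℝ) * b := by
    have : α - 1 / q ≤ (M / q : ℝ) := by
      rw [sub_le_iff_le_add, ← add_div, le_div_iff₀ hq0]; linarith
    calc α * b - b / q = (α - 1/q) * b := by ring
      _ ≤ _ := by gcongr
  have m2 : (((min (M+1) q : ℕ) : ℝ) / q : ℝ) * b ≤ α * b + b / q := by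
    have : (((min (M+1) q : ℕ) : ℝ) / q : ℝ) ≤ α + 1 / q := by
      rw [div_le_iff₀ hq0]
      have h8 : ((min (M+1) q : ℕ) : ℝ) ≤ M + 1 := by exact_mod_cast min_le_left _ _
      have : (α + 1/q) * (q:ℝ) = α * q + 1 := by field_simp
      linarith
    calc _ ≤ (α + 1/q) * b := by gcongr
      _ = _ := by ring
  have hbE : b / q ≤ ((B:ℝ) - A) / q := by gcongr
  have fin : |a - α * b| ≤ E + ((B:ℝ) - A) / q := by
    rw [abs_le]; constructor <;> linarith [E1.1, E2.2]
  refine fin.trans ?_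
  have e8 : (q:ℝ) ^ (-(1/8) : ℝ) = (q:ℝ) ^ (7/8:ℝ) / q := by
    rw [← Real.rpow_sub_one hq0.ne']; norm_num
  rw [e8, hEdef]
  have hx : ((B:ℝ) - A) / q ≤ X / k / q := by gcongr
  calc C * (((B:ℝ) - A) / q + 1) * (q : ℝ) ^ (7/8 : ℝ) + ((B:ℝ) - A) / q
      ≤ C * (X / k / q + X / k / q) * (q : ℝ) ^ (7/8 : ℝ) + 1 * (X / k / q) * 1 := by
        gcongr
        linarith
    _ ≤ C * (X / k / q + X / k / q) * (q : ℝ) ^ (7/8 : ℝ) + C * (X / k / q) * (q:ℝ) ^ (7/8:ℝ) := by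
        gcongr
    _ = _ := by ring
end C4

namespace C4
open Finset

noncomputable def R1 (N X : ℕ) : ℝ :=
  ∑ n ∈ Icc 1 N, ∑ k ∈ Icc 1 N, ∑ q ∈ Icc 1 X, (({p ∈ Icc 1 X | Base N X n k q p} : Finset ℕ).card : ℝ)

lemma ncard_eq (α : ℚ) (U : ℝ) (hU : 2 ≤ U) :
    (({x : ℕ × ℕ × ℕ × ℕ | Case4 α U x.1 x.2.1 x.2.2.1 x.2.2.2}.ncard : ℝ)) =
    ∑ n ∈ Icc 1 ⌊U⌋₊, ∑ k ∈ Icc 1 ⌊U⌋₊, ∑ q ∈ Icc 1 ⌊U^2⌋₊,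
      (({p ∈ Icc 1 ⌊U^2⌋₊ | Base ⌊U⌋₊ ⌊U^2⌋₊ n k q p ∧ (modInv p q : ℝ) ≤ (α : ℝ) * p} : Finset ℕ).card : ℝ) := by
  classical
  set N := ⌊U⌋₊ with hN
  set X := ⌊U^2⌋₊ with hX
  have hs : {x : ℕ × ℕ × ℕ × ℕ | Case4 α U x.1 x.2.1 x.2.2.1 x.2.2.2} =
      ↑(((Icc 1 N ×ˢ Icc 1 N ×ˢ Icc 1 X ×ˢ Icc 1 X).filter
        (fun y : ℕ × ℕ × ℕ × ℕ => Base N X y.1 y.2.1 y.2.2.1 y.2.2.2 ∧ (modInv y.2.2.2 y.2.2.1 : ℝ) ≤ (α : ℝ) * y.2.2.2)).image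
        (fun y : ℕ × ℕ × ℕ × ℕ => (y.2.2.2, y.2.2.1, y.1, y.2.1))) := by
    ext ⟨p, q, n, k⟩
    simp only [Set.mem_ofPred_eq, coe_image, Set.mem_image, Prod.exists, mem_coe, mem_filter, mem_product, mem_Icc]
    have e1 : ∀ m : ℕ, U < (m:ℝ) ↔ N < m := fun m => by
      rw [hN, Nat.floor_lt (by linarith)]
    have e2 : ∀ m : ℕ, (m:ℝ) ≤ U ^ 2 ↔ m ≤ X := fun m => by
      rw [hX, Nat.le_floor_iff (by positivity)]
    have e3 : ∀ m : ℕ, (m:ℝ) ≤ U ↔ m ≤ N := fun m => by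
      rw [hN, Nat.le_floor_iff (by linarith)]
    unfold Case4 Base
    rw [e1, e2, e3]
    constructor
    · rintro ⟨h1, h2, h3, h4, h5, h6, h7, h8, h9, h10⟩
      have : p ≤ k * p := Nat.le_mul_of_pos_left p h7
      exact ⟨n, k, q, p, ⟨⟨⟨by omega, h9⟩, ⟨h7, by omega⟩, ⟨h2, by omega⟩, by omega, by omega⟩, ⟨h1, h3, h4, h6, h8⟩, h10⟩, rfl⟩
    · rintro ⟨n', k', q', p', ⟨⟨⟨a1, a2⟩, ⟨a3, a4⟩, ⟨a5, a6⟩, a7, a8⟩, ⟨h1, h3, h4, h6, h8⟩, h10⟩, h⟩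
      simp only [Prod.mk.injEq] at h
      obtain ⟨rfl, rfl, rfl, rfl⟩ := h
      have h11 : 1 ≤ n' * q' := Nat.mul_pos a1 a5
      have h12 : 1 ≤ k' * p' := Nat.mul_pos a3 a7
      exact ⟨h1, a5, h3, h4, by omega, h6, a3, h8, a2, h10⟩
  rw [hs, Set.ncard_coe_finset, Finset.card_image_of_injective _ (by
    rintro ⟨a, b, c, d⟩ ⟨a', b', c', d'⟩ h
    simp only [Prod.mk.injEq] at h ⊢
    tauto)]
  rw [Finset.card_filter, Finset.sum_product]
  simp only [Finset.sum_product]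
  push_cast
  simp only [Finset.card_filter]
  push_cast
  rfl

lemma psum (s : ℝ) (h0 : 0 < s) (h1 : s < 1) (m : ℕ) :
    ∑ q ∈ Icc 1 m, (q:ℝ) ^ (-s) ≤ (m:ℝ) ^ (1 - s) / (1 - s) := by
  have ht : 0 < 1 - s := by linarith
  induction m with
  | zero => simp [ht.ne']
  | succ m ih =>
    rw [Finset.sum_Icc_succ_top (by omega)]
    refine (add_le_add_left ih _).trans ?_
    rw [← le_sub_iff_add_le', ← sub_div, le_div_iff₀ ht]
    have hm : (0:ℝ) < ((m + 1 : ℕ) : ℝ) := by positivity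
    have h2 := rpow_one_add_le_one_add_mul_self (s := -(1 / ((m + 1 : ℕ) : ℝ))) (p := 1 - s) (by
      have : 1 / ((m + 1 : ℕ) : ℝ) ≤ 1 := by rw [div_le_one hm]; push_cast; linarith [(Nat.cast_nonneg m : (0:ℝ) ≤ m)]
      linarith) ht.le (by linarith)
    have e1 : 1 + -(1 / ((m + 1 : ℕ) : ℝ)) = (m:ℝ) / ((m+1:ℕ):ℝ) := by
      push_cast; field_simp; ring
    rw [e1, Real.div_rpow (by positivity) hm.le, div_le_iff₀ (by positivity)] at h2
    have e2 : ((m + 1 : ℕ) : ℝ) ^ (-s) = ((m + 1 : ℕ) : ℝ) ^ (1 - s) / ((m+1:ℕ):ℝ) := by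
      rw [← Real.rpow_sub_one hm.ne']; congr 1; ring
    rw [e2]
    have e3 : (1 + (1 - s) * -(1 / ((m + 1:ℕ):ℝ))) * ((m + 1 : ℕ):ℝ) ^ (1 - s) = ((m + 1 : ℕ):ℝ) ^ (1 - s) - ((m + 1 : ℕ) : ℝ) ^ (1 - s) / ((m+1:ℕ):ℝ) * (1 - s) := by ring
    linarith

lemma harm_le (N : ℕ) : ∑ a ∈ Icc 1 N, (1 / a : ℝ) ≤ 1 + Real.log N := by
  have h := harmonic_le_one_add_log N
  refine le_trans ?_ h
  rw [harmonic_eq_sum_Icc]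
  push_cast
  simp only [one_div]
  exact le_rfl

lemma reduction : ∃ C : ℝ, 1 ≤ C ∧ ∀ (α : ℚ) (_ : 0 < α) (_ : α ≤ 1) (U : ℝ) (_ : 2 ≤ U),
    |(({x : ℕ × ℕ × ℕ × ℕ | Case4 α U x.1 x.2.1 x.2.2.1 x.2.2.2}.ncard : ℝ)) - α * R1 ⌊U⌋₊ ⌊U^2⌋₊| ≤ C * U ^ 4 := by
  obtain ⟨C, hC, hE⟩ := fibre_bound
  obtain ⟨C2, hC2, hlog⟩ := log_bound (1/8) (by norm_num)
  refine ⟨C * C2 * (8/7) * 8, by nlinarith, ?_⟩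
  intro α h0 h1 U hU
  rw [ncard_eq α U hU]
  unfold R1
  have hα0 : (0:ℝ) < α := by exact_mod_cast h0
  have hα1 : (α:ℝ) ≤ 1 := by exact_mod_cast h1
  have hN : (⌊U⌋₊:ℝ) ≤ U := Nat.floor_le (by linarith)
  have hX : (⌊U^2⌋₊:ℝ) ≤ U^2 := Nat.floor_le (by positivity)
  have hN1 : 1 ≤ ⌊U⌋₊ := by rw [Nat.one_le_floor_iff]; linarith
  set N := ⌊U⌋₊
  set X := ⌊U^2⌋₊
  simp only [Finset.mul_sum]
  simp only [← Finset.sum_sub_distrib]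
  have hU0 : (0:ℝ) < U := by linarith
  calc _ ≤ ∑ n ∈ Icc 1 N, ∑ k ∈ Icc 1 N, ∑ q ∈ Icc 1 X, (if n * q ≤ X then C * (X / k) * (q : ℝ) ^ (-(1/8) : ℝ) else 0) := by
        refine (Finset.abs_sum_le_sum_abs _ _).trans (Finset.sum_le_sum fun n hn => ?_)
        refine (Finset.abs_sum_le_sum_abs _ _).trans (Finset.sum_le_sum fun k hk => ?_)
        refine (Finset.abs_sum_le_sum_abs _ _).trans (Finset.sum_le_sum fun q hq => ?_)
        exact hE α hα0 hα1 N X n k q (mem_Icc.1 hq).1 (mem_Icc.1 hk).1 (mem_Icc.1 hn).1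
    _ ≤ ∑ n ∈ Icc 1 N, ∑ k ∈ Icc 1 N, C * (U^2 * (1 / k)) * ((8/7) * (U ^ (7/4:ℝ) * (n:ℝ) ^ (-(7/8):ℝ))) := by
        refine Finset.sum_le_sum fun n hn => Finset.sum_le_sum fun k hk => ?_
        have hn1 := (mem_Icc.1 hn).1
        have hk1 := (mem_Icc.1 hk).1
        have hn0 : (0:ℝ) < n := by exact_mod_cast hn1
        rw [← Finset.sum_filter, ← Finset.mul_sum]
        have hsub : (Icc 1 X).filter (fun q => n * q ≤ X) ⊆ Icc 1 (X / n) := by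
          intro q hq
          simp only [mem_filter, mem_Icc] at hq ⊢
          refine ⟨hq.1.1, ?_⟩
          rw [Nat.le_div_iff_mul_le (by omega), mul_comm]; exact hq.2
        have h5 : ∑ q ∈ (Icc 1 X).filter (fun q => n * q ≤ X), (q:ℝ) ^ (-(1/8):ℝ) ≤ (8/7) * (U ^ (7/4:ℝ) * (n:ℝ) ^ (-(7/8):ℝ)) := by
          calc _ ≤ ∑ q ∈ Icc 1 (X / n), (q:ℝ) ^ (-(1/8):ℝ) :=
                Finset.sum_le_sum_of_subset_of_nonneg hsub (by intros; positivity)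
            _ ≤ ((X / n : ℕ):ℝ) ^ (1 - 1/8 : ℝ) / (1 - 1/8) := psum (1/8) (by norm_num) (by norm_num) _
            _ ≤ (U^2 / n) ^ (1 - 1/8 : ℝ) / (1 - 1/8) := by
                gcongr
                exact Nat.cast_div_le.trans (by gcongr)
            _ = _ := by
                rw [Real.div_rpow (by positivity) hn0.le, Real.rpow_neg hn0.le, ← Real.rpow_natCast, ← Real.rpow_mul hU0.le]
                norm_num
                ring
        have h6 : (X:ℝ) / k ≤ U^2 * (1 / k) := by
          rw [mul_one_div]; gcongr
        gcongr
    _ = C * U^2 * U ^ (7/4:ℝ) * (8/7) * (∑ n ∈ Icc 1 N, (n:ℝ) ^ (-(7/8):ℝ)) * (∑ k ∈ Icc 1 N, (1 / k : ℝ)) := by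
        rw [mul_assoc, Finset.sum_mul_sum, Finset.mul_sum]
        refine Finset.sum_congr rfl fun n _ => ?_
        rw [Finset.mul_sum]
        refine Finset.sum_congr rfl fun k _ => ?_
        ring
    _ ≤ C * U^2 * U ^ (7/4:ℝ) * (8/7) * (8 * U ^ (1/8:ℝ)) * (C2 * U ^ (1/8:ℝ)) := by
        have h5 : ∑ n ∈ Icc 1 N, (n:ℝ) ^ (-(7/8):ℝ) ≤ 8 * U ^ (1/8:ℝ) := by
          refine (psum (7/8) (by norm_num) (by norm_num) N).trans ?_
          have e : (N:ℝ) ^ (1 - 7/8:ℝ) / (1 - 7/8) = 8 * (N:ℝ) ^ (1/8:ℝ) := by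
            rw [show (1 - 7/8:ℝ) = 1/8 by norm_num]; ring
          rw [e]
          have : (N:ℝ) ^ (1/8:ℝ) ≤ U ^ (1/8:ℝ) := Real.rpow_le_rpow (by positivity) hN (by norm_num)
          linarith
        have h6 : ∑ k ∈ Icc 1 N, (1 / k : ℝ) ≤ C2 * U ^ (1/8:ℝ) := by
          refine (harm_le N).trans (le_trans ?_ (hlog U (by linarith)))
          have : Real.log N ≤ Real.log U := Real.log_le_log (by exact_mod_cast hN1) hN
          linarith
        gcongr
    _ = C * C2 * (8/7) * 8 * U ^ 4 := by
        have : U^4 = U^2 * U ^ (7/4:ℝ) * U ^ (1/8:ℝ) * U ^ (1/8:ℝ) := by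
          have e : U^2 = U ^ (2:ℝ) := by norm_cast
          have e' : U^4 = U ^ (4:ℝ) := by norm_cast
          rw [e, e', ← Real.rpow_add hU0, ← Real.rpow_add hU0, ← Real.rpow_add hU0]; norm_num
        rw [this]; ring
end C4

namespace C4
open Finset

lemma mvt_anti (f F : ℝ → ℝ) (a b x y : ℝ) (hF : ∀ x ∈ Set.Icc a b, HasDerivAt F (f x) x)
    (hm : AntitoneOn f (Set.Icc a b)) (hax : a ≤ x) (hxy : x ≤ y) (hyb : y ≤ b) :
    f y * (y - x) ≤ F y - F x ∧ F y - F x ≤ f x * (y - x) := by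
  rcases hxy.eq_or_lt with rfl | h
  · simp
  obtain ⟨c, hc, hc'⟩ := exists_hasDerivAt_eq_slope F f h
    (fun t ht => (hF t ⟨hax.trans ht.1, ht.2.trans hyb⟩).continuousAt.continuousWithinAt)
    (fun t ht => hF t ⟨hax.trans ht.1.le, ht.2.le.trans hyb⟩)
  have h0 : 0 < y - x := by linarith
  have e : F y - F x = f c * (y - x) := by rw [hc']; field_simp
  rw [e]
  have hx : x ∈ Set.Icc a b := ⟨hax, hxy.trans hyb⟩
  have hy : y ∈ Set.Icc a b := ⟨hax.trans hxy, hyb⟩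
  have hcc : c ∈ Set.Icc a b := ⟨hax.trans hc.1.le, hc.2.le.trans hyb⟩
  exact ⟨mul_le_mul_of_nonneg_right (hm hcc hy hc.2.le) h0.le, mul_le_mul_of_nonneg_right (hm hx hcc hc.1.le) h0.le⟩

lemma L1_nat (f F : ℝ → ℝ) (a b : ℝ) (hF : ∀ x ∈ Set.Icc a b, HasDerivAt F (f x) x)
    (hm : AntitoneOn f (Set.Icc a b)) (m : ℕ) (ham : a ≤ m) (n : ℕ) (hmn : m ≤ n) : (n:ℝ) ≤ b →
    ∑ k ∈ Ioc m n, f k ≤ F n - F m ∧ F n - F m ≤ f m - f n + ∑ k ∈ Ioc m n, f k := by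
  induction n, hmn using Nat.le_induction with
  | base => simp
  | succ n hmn ih =>
    intro hb
    push_cast at hb
    have hmn' : (m:ℝ) ≤ n := by exact_mod_cast hmn
    obtain ⟨h1, h2⟩ := ih (by linarith)
    obtain ⟨h3, h4⟩ := mvt_anti f F a b n (n+1) hF hm (by linarith) (by linarith) hb
    rw [Finset.sum_Ioc_succ_top hmn]
    push_cast
    constructor <;> linarith

lemma L1_anti (f F : ℝ → ℝ) (a b B : ℝ) (h0 : 0 ≤ a) (hab : a ≤ b)
    (hF : ∀ x ∈ Set.Icc a b, HasDerivAt F (f x) x)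
    (hB : ∀ x ∈ Set.Icc a b, 0 ≤ f x ∧ f x ≤ B)
    (hm : AntitoneOn f (Set.Icc a b)) :
    |∑ k ∈ Ioc ⌊a⌋₊ ⌊b⌋₊, f k - (F b - F a)| ≤ B := by
  have hb0 := h0.trans hab
  rcases (Nat.floor_mono hab).eq_or_lt with h | h
  · rw [h, Ioc_self, sum_empty, zero_sub, abs_neg]
    obtain ⟨h1, h2⟩ := mvt_anti f F a b a b hF hm le_rfl hab le_rfl
    have h3 : b - a ≤ 1 := by
      have := Nat.lt_floor_add_one b
      rw [← h] at this
      linarith [Nat.floor_le h0]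
    obtain ⟨h4, h5⟩ := hB a ⟨le_rfl, hab⟩
    obtain ⟨h6, h7⟩ := hB b ⟨hab, le_rfl⟩
    have : 0 ≤ F b - F a := le_trans (mul_nonneg h6 (by linarith)) h1
    rw [abs_of_nonneg this]
    nlinarith
  · set m := ⌊a⌋₊ + 1 with hm'
    set n := ⌊b⌋₊ with hn
    have ham : a ≤ m := by rw [hm']; push_cast; exact (Nat.lt_floor_add_one a).le
    have ham' : (m:ℝ) - a ≤ 1 := by rw [hm']; push_cast; linarith [Nat.floor_le h0]
    have hnb : (n:ℝ) ≤ b := Nat.floor_le hb0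
    have hnb' : b - n ≤ 1 := by linarith [Nat.lt_floor_add_one b]
    have hmn : m ≤ n := h
    have hmnr : (m:ℝ) ≤ n := by exact_mod_cast hmn
    obtain ⟨h1, h2⟩ := L1_nat f F a b hF hm m ham n hmn hnb
    have e : ∑ k ∈ Ioc ⌊a⌋₊ n, f k = f m + ∑ k ∈ Ioc m n, f k := by
      rw [← Finset.sum_Ioc_consecutive _ (Nat.le_succ ⌊a⌋₊) hmn]
      simp [m]
    rw [e]
    obtain ⟨h3, h4⟩ := mvt_anti f F a b a m hF hm le_rfl ham (hmnr.trans hnb)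
    obtain ⟨h5, h6⟩ := mvt_anti f F a b n b hF hm (ham.trans hmnr) hnb le_rfl
    obtain ⟨h7, h8⟩ := hB a ⟨le_rfl, hab⟩
    obtain ⟨h9, h10⟩ := hB b ⟨hab, le_rfl⟩
    obtain ⟨h11, h12⟩ := hB m ⟨ham, hmnr.trans hnb⟩
    obtain ⟨h13, h14⟩ := hB n ⟨ham.trans hmnr, hnb⟩
    have := mul_nonneg h11 (sub_nonneg.2 ham)
    have := mul_nonneg h9 (sub_nonneg.2 hnb)
    rw [abs_le]
    constructor <;> nlinarith

lemma card_floor (a b : ℝ) (h0 : 0 ≤ a) (hab : a ≤ b) :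
    |((#(Ioc ⌊a⌋₊ ⌊b⌋₊) : ℕ) : ℝ) - (b - a)| ≤ 1 := by
  rw [Nat.card_Ioc, Nat.cast_sub (Nat.floor_mono hab), abs_le]
  have := Nat.floor_le h0
  have := Nat.floor_le (h0.trans hab)
  have := Nat.lt_floor_add_one a
  have := Nat.lt_floor_add_one b
  constructor <;> linarith

lemma L1 (f F : ℝ → ℝ) (a b B : ℝ) (h0 : 0 ≤ a) (hab : a ≤ b)
    (hF : ∀ x ∈ Set.Icc a b, HasDerivAt F (f x) x)
    (hB : ∀ x ∈ Set.Icc a b, 0 ≤ f x ∧ f x ≤ B)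
    (hm : AntitoneOn f (Set.Icc a b) ∨ MonotoneOn f (Set.Icc a b)) :
    |∑ k ∈ Ioc ⌊a⌋₊ ⌊b⌋₊, f k - (F b - F a)| ≤ 2 * B := by
  have hB0 : 0 ≤ B := (hB a ⟨le_rfl, hab⟩).1.trans (hB a ⟨le_rfl, hab⟩).2
  rcases hm with hm | hm
  · exact (L1_anti f F a b B h0 hab hF hB hm).trans (by linarith)
  · have h1 := L1_anti (fun x => B - f x) (fun x => B * x - F x) a b B h0 hab
      (fun x hx => by simpa using ((hasDerivAt_id x).const_mul B).fun_sub (hF x hx))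
      (fun x hx => ⟨by linarith [(hB x hx).2], by linarith [(hB x hx).1]⟩)
      (fun x hx y hy hxy => by have := hm hx hy hxy; simp only; linarith)
    have h2 := card_floor a b h0 hab
    rw [Finset.sum_sub_distrib, Finset.sum_const, nsmul_eq_mul] at h1
    rw [abs_le] at *
    obtain ⟨h3, h4⟩ := h1
    obtain ⟨h5, h6⟩ := h2
    constructor <;> nlinarith

/-- size of the increment of `F` -/
lemma F_inc (f F : ℝ → ℝ) (a b B : ℝ) (hab : a ≤ b)
    (hF : ∀ x ∈ Set.Icc a b, HasDerivAt F (f x) x)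
    (hB : ∀ x ∈ Set.Icc a b, 0 ≤ f x ∧ f x ≤ B) : |F b - F a| ≤ B * (b - a) := by
  rcases hab.eq_or_lt with rfl | h
  · simp
  obtain ⟨c, hc, hc'⟩ := exists_hasDerivAt_eq_slope F f h
    (fun t ht => (hF t ht).continuousAt.continuousWithinAt)
    (fun t ht => hF t ⟨ht.1.le, ht.2.le⟩)
  have h0 : 0 < b - a := by linarith
  have e : F b - F a = f c * (b - a) := by rw [hc']; field_simp
  obtain ⟨h1, h2⟩ := hB c ⟨hc.1.le, hc.2.le⟩
  rw [e, abs_of_nonneg (by positivity)]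
  gcongr

end C4

namespace C4
open Finset ArithmeticFunction

lemma mu_abs (d : ℕ) : |((moebius d : ℤ) : ℝ)| ≤ 1 := by
  exact_mod_cast abs_moebius_le_one (n := d)

lemma phi_mu (p : ℕ) (hp : 0 < p) :
    ((Nat.totient p : ℕ) : ℝ) / p = ∑ d ∈ p.divisors, ((moebius d : ℤ) : ℝ) / d := by
  have h := (sum_eq_iff_sum_mul_moebius_eq (R := ℝ) (f := fun n => ((Nat.totient n : ℕ):ℝ)) (g := fun n => (n:ℝ))).1
    (fun n _ => by exact_mod_cast Nat.sum_totient n) p hp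
  rw [← h, Nat.sum_divisorsAntidiagonal (fun a b => ((moebius a : ℤ):ℝ) * (b:ℝ)), Finset.sum_div]
  refine Finset.sum_congr rfl fun d hd => ?_
  have hd' := Nat.dvd_of_mem_divisors hd
  have hd0 : (d:ℝ) ≠ 0 := by exact_mod_cast (Nat.pos_of_mem_divisors hd).ne'
  have hp0 : (p:ℝ) ≠ 0 := by exact_mod_cast hp.ne'
  rw [Nat.cast_div hd' hd0]
  field_simp

lemma mu_gcd (p q : ℕ) (hp : 0 < p) :
    (if Nat.Coprime p q then (1:ℝ) else 0) = ∑ d ∈ p.divisors with d ∣ q, ((moebius d : ℤ) : ℝ) := by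
  have e : (p.divisors.filter (· ∣ q)) = (Nat.gcd p q).divisors := by
    ext d
    simp only [mem_filter, Nat.mem_divisors, Nat.dvd_gcd_iff]
    have : Nat.gcd p q ≠ 0 := (Nat.gcd_pos_of_pos_left q hp).ne'
    have := hp.ne'
    tauto
  rw [e]
  have h := congrArg (fun f : ArithmeticFunction ℤ => f (Nat.gcd p q)) coe_zeta_mul_moebius
  simp only [coe_zeta_mul_apply, one_apply] at h
  have h' : (∑ d ∈ (Nat.gcd p q).divisors, ((moebius d : ℤ) : ℝ)) = ((∑ d ∈ (Nat.gcd p q).divisors, moebius d : ℤ) : ℝ) := by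
    push_cast; rfl
  rw [h', h]
  push_cast
  rfl

lemma cop_count (p : ℕ) (hp : 0 < p) (z : ℝ) (hz : 0 ≤ z) :
    |((#{q ∈ Icc 1 ⌊z⌋₊ | Nat.Coprime p q} : ℕ) : ℝ) - ((Nat.totient p : ℕ) : ℝ) / p * z| ≤ #p.divisors := by
  have h1 : ((#{q ∈ Icc 1 ⌊z⌋₊ | Nat.Coprime p q} : ℕ) : ℝ) = ∑ d ∈ p.divisors, ((moebius d : ℤ) : ℝ) * ((⌊z⌋₊ / d : ℕ) : ℝ) := by
    rw [Finset.card_filter]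
    push_cast
    rw [Finset.sum_congr rfl fun q _ => mu_gcd p q hp]
    simp only [Finset.sum_filter]
    rw [Finset.sum_comm]
    refine Finset.sum_congr rfl fun d hd => ?_
    rw [← Finset.sum_filter, Finset.sum_const, nsmul_eq_mul, mul_comm]
    congr 2
    have := Nat.Ioc_filter_dvd_card_eq_div ⌊z⌋₊ d
    rw [← this]
    congr 1
  rw [h1, phi_mu p hp, Finset.sum_mul, ← Finset.sum_sub_distrib]
  refine (Finset.abs_sum_le_sum_abs _ _).trans ?_
  rw [Finset.card_eq_sum_ones]
  push_cast
  refine Finset.sum_le_sum fun d hd => ?_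
  have hd0 : (0:ℝ) < d := by exact_mod_cast (Nat.pos_of_mem_divisors hd)
  have e : ((moebius d : ℤ) : ℝ) * ((⌊z⌋₊ / d : ℕ) : ℝ) - ((moebius d : ℤ) : ℝ) / d * z =
    ((moebius d : ℤ) : ℝ) * (((⌊z⌋₊ / d : ℕ) : ℝ) - z / d) := by ring
  rw [e, abs_mul]
  refine mul_le_one₀ (mu_abs d) (abs_nonneg _) ?_
  rw [← Nat.floor_div_natCast, abs_le]
  have h2 := Nat.floor_le (a := z / d) (by positivity)
  have h3 := Nat.lt_floor_add_one (z / d)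
  constructor <;> linarith

lemma hasSum_mu : HasSum (fun d : ℕ => ((moebius d : ℤ) : ℝ) / (d:ℝ)^2) (6 / Real.pi ^ 2) := by
  have h2 : (1:ℝ) < (2:ℂ).re := by norm_num
  have h1 := LSeries_zeta_mul_Lseries_moebius h2
  rw [LSeries_zeta_eq_riemannZeta h2, riemannZeta_two] at h1
  have h3 := (LSeriesSummable_moebius_iff.2 h2).LSeriesHasSum
  have hpi : (Real.pi:ℂ) ≠ 0 := by exact_mod_cast Real.pi_ne_zero
  have h4 : LSeries (fun n => ((moebius n : ℤ):ℂ)) 2 = ((6 / Real.pi^2 : ℝ) : ℂ) := by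
    push_cast
    field_simp at h1 ⊢
    linear_combination h1
  rw [h4] at h3
  rw [← Complex.hasSum_ofReal]
  unfold LSeriesHasSum at h3
  convert! h3 using 2 with d
  rcases Nat.eq_zero_or_pos d with rfl | hd
  · simp
  · rw [LSeries.term_of_ne_zero hd.ne']
    push_cast
    norm_num

lemma mu_tail (n : ℕ) :
    |∑ d ∈ Icc 1 n, ((moebius d : ℤ) : ℝ) / (d:ℝ)^2 - 6 / Real.pi ^ 2| ≤ (2:ℝ) / ((n:ℝ) + 1) := by
  have h := hasSum_mu.tendsto_sum_nat
  have h1 : Filter.Tendsto (fun m => |∑ d ∈ Icc 1 n, ((moebius d : ℤ) : ℝ) / (d:ℝ)^2 - ∑ d ∈ range m, ((moebius d : ℤ) : ℝ) / (d:ℝ)^2|)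
    Filter.atTop (nhds _) := (tendsto_const_nhds.sub h).abs
  refine le_of_tendsto h1 ?_
  filter_upwards [Filter.eventually_ge_atTop (n+1)] with m hm
  have e : ∑ d ∈ range m, ((moebius d : ℤ) : ℝ) / (d:ℝ)^2 = ∑ d ∈ Icc 1 n, ((moebius d : ℤ) : ℝ) / (d:ℝ)^2
      + ∑ d ∈ Ioo n m, ((moebius d : ℤ) : ℝ) / (d:ℝ)^2 := by
    have : range m = insert 0 (Icc 1 n ∪ Ioo n m) := by
      ext x; simp only [mem_range, mem_insert, mem_union, mem_Icc, mem_Ioo]; omega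
    rw [this, sum_insert (by simp), sum_union]
    · simp
    · rw [Finset.disjoint_left]; intro x; simp only [mem_Icc, mem_Ioo]; omega
  rw [e, sub_add_cancel_left, abs_neg]
  refine (Finset.abs_sum_le_sum_abs _ _).trans (le_trans ?_ (sum_Ioo_inv_sq_le n m))
  refine Finset.sum_le_sum fun d _ => ?_
  rw [abs_div, abs_of_nonneg (a := (d:ℝ)^2) (by positivity), div_eq_mul_inv]
  exact mul_le_of_le_one_left (by positivity) (mu_abs d)

/-- Weighted summation with weight `φ(p)/p`. -/
lemma L2 (f F : ℝ → ℝ) (a b B : ℝ) (h0 : 1 ≤ a) (hab : a ≤ b)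
    (hF : ∀ x ∈ Set.Icc a b, HasDerivAt F (f x) x)
    (hB : ∀ x ∈ Set.Icc a b, 0 ≤ f x ∧ f x ≤ B)
    (hm : AntitoneOn f (Set.Icc a b) ∨ MonotoneOn f (Set.Icc a b)) :
    |∑ p ∈ Ioc ⌊a⌋₊ ⌊b⌋₊, ((Nat.totient p : ℕ) : ℝ) / p * f p - 6 / Real.pi ^ 2 * (F b - F a)| ≤
      B * (4 + 2 * Real.log b) := by
  have hB0 : 0 ≤ B := (hB a ⟨le_rfl, hab⟩).1.trans (hB a ⟨le_rfl, hab⟩).2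
  set X := ⌊b⌋₊ with hX
  have hX1 : 1 ≤ X := Nat.le_floor (by simpa using h0.trans hab)
  have e1 : ∑ p ∈ Ioc ⌊a⌋₊ X, ((Nat.totient p : ℕ) : ℝ) / p * f p =
      ∑ d ∈ Icc 1 X, ((moebius d : ℤ) : ℝ) / d * ∑ m ∈ Ioc ⌊a / d⌋₊ ⌊b / d⌋₊, f (d * m) := by
    have : ∀ p ∈ Ioc ⌊a⌋₊ X, ((Nat.totient p : ℕ) : ℝ) / p * f p =
        ∑ d ∈ Icc 1 X, if d ∣ p then ((moebius d : ℤ) : ℝ) / d * f p else 0 := by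
      intro p hp
      rw [mem_Ioc] at hp
      rw [phi_mu p (by omega), Finset.sum_mul, ← Finset.sum_filter]
      refine Finset.sum_congr ?_ fun _ _ => rfl
      ext d
      simp only [Nat.mem_divisors, mem_filter, mem_Icc]
      constructor
      · rintro ⟨h1, h2⟩
        exact ⟨⟨Nat.pos_of_dvd_of_pos h1 (by omega), (Nat.le_of_dvd (by omega) h1).trans hp.2⟩, h1⟩
      · rintro ⟨h1, h2⟩
        exact ⟨h2, by omega⟩
    rw [Finset.sum_congr rfl this, Finset.sum_comm]
    refine Finset.sum_congr rfl fun d hd => ?_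
    rw [mem_Icc] at hd
    rw [Finset.mul_sum, ← Finset.sum_filter, Nat.floor_div_natCast, Nat.floor_div_natCast, ← hX]
    symm
    refine Finset.sum_bij (fun m _ => d * m) ?_ ?_ ?_ ?_
    · intro m hm
      simp only [mem_filter, mem_Ioc] at hm ⊢
      refine ⟨⟨?_, ?_⟩, Dvd.intro _ rfl⟩
      · have := (Nat.div_lt_iff_lt_mul hd.1).1 hm.1
        rwa [mul_comm]
      · have := (Nat.le_div_iff_mul_le hd.1).1 hm.2
        rwa [mul_comm]
    · intro m _ m' _ h
      exact Nat.eq_of_mul_eq_mul_left hd.1 h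
    · intro p hp
      simp only [mem_filter, mem_Ioc] at hp
      obtain ⟨⟨h1, h2⟩, m, rfl⟩ := hp
      refine ⟨m, ?_, rfl⟩
      rw [mem_Ioc]
      exact ⟨(Nat.div_lt_iff_lt_mul hd.1).2 (by rwa [mul_comm]), (Nat.le_div_iff_mul_le hd.1).2 (by rwa [mul_comm])⟩
    · intro m _
      push_cast
      rfl
  have e2 : ∀ d ∈ Icc 1 X, |∑ m ∈ Ioc ⌊a / d⌋₊ ⌊b / d⌋₊, f (d * m) - (F b - F a) / d| ≤ 2 * B := by
    intro d hd
    rw [mem_Icc] at hd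
    have hd0 : (0:ℝ) < d := by exact_mod_cast hd.1
    have key : ∀ x ∈ Set.Icc (a/d) (b/d), (d:ℝ) * x ∈ Set.Icc a b := by
      intro x hx
      rw [Set.mem_Icc, div_le_iff₀ hd0, le_div_iff₀ hd0] at hx
      exact ⟨by linarith [hx.1], by linarith [hx.2]⟩
    have h := L1 (fun x => f (d * x)) (fun x => F (d * x) / d) (a/d) (b/d) B (by positivity) (by gcongr)
      (fun x hx => by
        have h1 := (hF (d * x) (key x hx)).comp x ((hasDerivAt_id x).const_mul (d:ℝ))
        have h2 := h1.div_const (d:ℝ)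
        simp only [mul_one] at h2
        rw [mul_div_assoc, div_self hd0.ne', mul_one] at h2
        exact h2)
      (fun x hx => hB _ (key x hx))
      (by
        rcases hm with hm | hm
        · left
          intro x hx y hy hxy
          exact hm (key x hx) (key y hy) (by gcongr)
        · right
          intro x hx y hy hxy
          exact hm (key x hx) (key y hy) (by gcongr))
    simp only [mul_div_cancel₀ _ hd0.ne'] at h
    rwa [← sub_div] at h
  set D := F b - F a with hD
  have e3 : ∑ p ∈ Ioc ⌊a⌋₊ X, ((Nat.totient p : ℕ) : ℝ) / p * f p - 6 / Real.pi ^ 2 * D =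
      ∑ d ∈ Icc 1 X, ((moebius d : ℤ) : ℝ) / d * (∑ m ∈ Ioc ⌊a / d⌋₊ ⌊b / d⌋₊, f (d * m) - D / d)
      + (∑ d ∈ Icc 1 X, ((moebius d : ℤ) : ℝ) / (d:ℝ)^2 - 6 / Real.pi ^ 2) * D := by
    rw [e1]
    simp only [mul_sub, Finset.sum_sub_distrib, sub_mul, Finset.sum_mul]
    have : ∑ d ∈ Icc 1 X, ((moebius d : ℤ) : ℝ) / d * (D / d) = ∑ d ∈ Icc 1 X, ((moebius d : ℤ) : ℝ) / (d:ℝ)^2 * D :=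
      Finset.sum_congr rfl fun d _ => by rw [sq, div_mul_div_comm, div_mul_eq_mul_div]
    rw [this]; ring
  rw [e3]
  refine (abs_add_le _ _).trans ?_
  have hXb : (X:ℝ) ≤ b := Nat.floor_le (by linarith)
  have g1 : |∑ d ∈ Icc 1 X, ((moebius d : ℤ) : ℝ) / d * (∑ m ∈ Ioc ⌊a / d⌋₊ ⌊b / d⌋₊, f (d * m) - D / d)| ≤
      2 * B * (1 + Real.log b) := by
    refine (Finset.abs_sum_le_sum_abs _ _).trans ?_
    calc _ ≤ ∑ d ∈ Icc 1 X, (1 / d : ℝ) * (2 * B) := by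
          refine Finset.sum_le_sum fun d hd => ?_
          rw [abs_mul, abs_div, Nat.abs_cast]
          have := e2 d hd
          have := mu_abs d
          gcongr
      _ = 2 * B * ∑ d ∈ Icc 1 X, (1 / d : ℝ) := by rw [← Finset.sum_mul, mul_comm]
      _ ≤ _ := by
          have := harm_le X
          have : Real.log X ≤ Real.log b := Real.log_le_log (by exact_mod_cast hX1) hXb
          gcongr
          linarith
  have g2 : |(∑ d ∈ Icc 1 X, ((moebius d : ℤ) : ℝ) / (d:ℝ)^2 - 6 / Real.pi ^ 2) * D| ≤ 2 * B := by
    rw [abs_mul]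
    have h1 := mu_tail X
    have h2 := F_inc f F a b B hab hF hB
    have h3 : b < X + 1 := Nat.lt_floor_add_one b
    calc _ ≤ 2 / ((X:ℝ) + 1) * (B * (b - a)) := by gcongr
      _ ≤ 2 / ((X:ℝ) + 1) * (B * (X + 1)) := by gcongr; linarith
      _ = 2 * B := by field_simp
  linarith

end C4

namespace C4
open Finset

noncomputable def H (N : ℕ) (T : ℝ) : ℝ := ∑ k ∈ Ioc 0 ⌊T⌋₊, ∑ n ∈ Ioc k N, min 1 ((T - k) / n)

lemma q_count (U : ℝ) (hU : 2 ≤ U) (p k n : ℕ) (hp : p ∈ Ioc ⌊U⌋₊ ⌊U^2⌋₊) (hk : k ∈ Ioc 0 ⌊U^2 / p⌋₊)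
    (hn : n ∈ Ioc k ⌊U⌋₊) :
    ({q ∈ Icc 1 ⌊U^2⌋₊ | Base ⌊U⌋₊ ⌊U^2⌋₊ n k q p} : Finset ℕ) =
      {q ∈ Icc 1 ⌊(p:ℝ) * min 1 ((U^2 / p - k) / n)⌋₊ | Nat.Coprime p q} := by
  rw [mem_Ioc] at hp hk hn
  have hN2 : 2 ≤ ⌊U⌋₊ := Nat.le_floor (by simpa using hU)
  have hp0 : (0:ℝ) < p := by exact_mod_cast (by omega : 0 < p)
  have hn0 : (0:ℝ) < n := by exact_mod_cast (by omega : 0 < n)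
  have hkT : (k:ℝ) ≤ U^2 / p := (Nat.le_floor_iff (by positivity)).1 hk.2
  have hz : 0 ≤ (p:ℝ) * min 1 ((U^2 / p - k) / n) :=
    mul_nonneg hp0.le (le_min zero_le_one (div_nonneg (by linarith) hn0.le))
  ext q
  rw [mem_filter, mem_filter, mem_Icc, mem_Icc]
  unfold Base
  rw [Nat.le_floor_iff hz, mul_min_of_nonneg _ _ hp0.le, le_min_iff, mul_one]
  have e : (q:ℝ) ≤ p * ((U^2 / p - k) / n) ↔ n * q + k * p ≤ ⌊U^2⌋₊ := by
    rw [Nat.le_floor_iff (by positivity), mul_div_assoc', le_div_iff₀ hn0]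
    push_cast
    have : (p:ℝ) * (U^2 / p - k) = U^2 - k * p := by field_simp
    rw [this]
    constructor <;> intro h <;> linarith
  rw [e, Nat.cast_le]
  constructor
  · rintro ⟨⟨h1, h2⟩, h3, h4, h5, h6, h7⟩
    exact ⟨⟨h1, h4.le, h6⟩, h3⟩
  · rintro ⟨⟨h1, h4, h6⟩, h3⟩
    refine ⟨⟨h1, by omega⟩, h3, ?_, hp.1, h6, hn.1⟩
    rcases h4.eq_or_lt with rfl | h
    · rw [Nat.coprime_self] at h3; omega
    · exact h

lemma R1_eq (U : ℝ) (hU : 2 ≤ U) : R1 ⌊U⌋₊ ⌊U^2⌋₊ =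
    ∑ p ∈ Ioc ⌊U⌋₊ ⌊U^2⌋₊, ∑ k ∈ Ioc 0 ⌊U^2 / p⌋₊, ∑ n ∈ Ioc k ⌊U⌋₊,
      ((#{q ∈ Icc 1 ⌊(p:ℝ) * min 1 ((U^2 / p - k) / n)⌋₊ | Nat.Coprime p q} : ℕ) : ℝ) := by
  have hN2 : 2 ≤ ⌊U⌋₊ := Nat.le_floor (by simpa using hU)
  have s1 : R1 ⌊U⌋₊ ⌊U^2⌋₊ = ∑ p ∈ Icc 1 ⌊U^2⌋₊, ∑ k ∈ Icc 1 ⌊U⌋₊, ∑ n ∈ Icc 1 ⌊U⌋₊,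
      ((#{q ∈ Icc 1 ⌊U^2⌋₊ | Base ⌊U⌋₊ ⌊U^2⌋₊ n k q p} : ℕ) : ℝ) := by
    unfold R1
    simp only [Finset.card_filter]
    push_cast
    rw [Finset.sum_comm (s := Icc 1 ⌊U^2⌋₊) (t := Icc 1 ⌊U⌋₊)]
    rw [Finset.sum_comm]
    refine Finset.sum_congr rfl fun k _ => ?_
    rw [Finset.sum_comm (s := Icc 1 ⌊U^2⌋₊) (t := Icc 1 ⌊U⌋₊)]
    refine Finset.sum_congr rfl fun n _ => ?_
    rw [Finset.sum_comm]
  rw [s1]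
  have s2 : Ioc ⌊U⌋₊ ⌊U^2⌋₊ ⊆ Icc 1 ⌊U^2⌋₊ := by
    intro p; simp only [mem_Ioc, mem_Icc]; omega
  rw [← Finset.sum_subset s2]
  · refine Finset.sum_congr rfl fun p hp => ?_
    have hp' := mem_Ioc.1 hp
    have hp0 : (0:ℝ) < p := by exact_mod_cast (by omega : 0 < p)
    have hpU : U < p := (Nat.floor_lt (by linarith)).1 hp'.1
    have hTU : U^2 / p ≤ U := by
      rw [div_le_iff₀ hp0]; nlinarith
    have s3 : Ioc 0 ⌊U^2 / p⌋₊ ⊆ Icc 1 ⌊U⌋₊ := by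
      have := Nat.floor_mono hTU
      intro k; simp only [mem_Ioc, mem_Icc]; omega
    rw [← Finset.sum_subset s3]
    · refine Finset.sum_congr rfl fun k hk => ?_
      have s4 : Ioc k ⌊U⌋₊ ⊆ Icc 1 ⌊U⌋₊ := by
        intro n; simp only [mem_Ioc, mem_Icc]; omega
      rw [← Finset.sum_subset s4]
      · refine Finset.sum_congr rfl fun n hn => ?_
        rw [q_count U hU p k n hp hk hn]
      · intro n hn hn'
        rw [Nat.cast_eq_zero, Finset.card_eq_zero, Finset.filter_eq_empty_iff]
        rintro q - ⟨h3, h4, h5, h6, h7⟩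
        rw [mem_Ioc] at hn'
        rw [mem_Icc] at hn
        omega
    · intro k hk hk'
      refine Finset.sum_eq_zero fun n hn => ?_
      rw [Nat.cast_eq_zero, Finset.card_eq_zero, Finset.filter_eq_empty_iff]
      rintro q - ⟨h3, h4, h5, h6, h7⟩
      apply hk'
      rw [mem_Icc] at hk
      rw [mem_Ioc, Nat.le_floor_iff (by positivity), le_div_iff₀ hp0]
      refine ⟨hk.1, ?_⟩
      have : k * p ≤ ⌊U^2⌋₊ := by omega
      have := (Nat.le_floor_iff (by positivity)).1 this
      push_cast at this
      exact this
  · intro p hp hp'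
    refine Finset.sum_eq_zero fun k hk => Finset.sum_eq_zero fun n hn => ?_
    rw [Nat.cast_eq_zero, Finset.card_eq_zero, Finset.filter_eq_empty_iff]
    rintro q - ⟨h3, h4, h5, h6, h7⟩
    rw [mem_Ioc] at hp'
    rw [mem_Icc] at hp
    omega

lemma R1_H : ∃ C : ℝ, 0 ≤ C ∧ ∀ U : ℝ, 2 ≤ U →
    |R1 ⌊U⌋₊ ⌊U^2⌋₊ - ∑ p ∈ Ioc ⌊U⌋₊ ⌊U^2⌋₊, ((Nat.totient p : ℕ):ℝ) * H ⌊U⌋₊ (U^2 / p)| ≤ C * U^4 := by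
  obtain ⟨C, hC, hdiv⟩ := div_bound (1/2) (by norm_num)
  refine ⟨2 * C, by linarith, fun U hU => ?_⟩
  rw [R1_eq U hU, ← Finset.sum_sub_distrib]
  have hU0 : 0 < U := by linarith
  calc _ ≤ ∑ p ∈ Ioc ⌊U⌋₊ ⌊U^2⌋₊, C * U^3 * (p:ℝ)^(-(1/2):ℝ) := by
        refine (Finset.abs_sum_le_sum_abs _ _).trans (Finset.sum_le_sum fun p hp => ?_)
        have hp' := mem_Ioc.1 hp
        have hp1 : 0 < p := by omega
        have hp0 : (0:ℝ) < p := by exact_mod_cast hp1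
        unfold H
        rw [Finset.mul_sum, ← Finset.sum_sub_distrib]
        have e : ((Nat.totient p : ℕ):ℝ) = ((Nat.totient p : ℕ):ℝ) / p * p := by field_simp
        calc _ ≤ ∑ k ∈ Ioc 0 ⌊U^2 / p⌋₊, (U * (C * (p:ℝ)^(1/2:ℝ))) := by
              refine (Finset.abs_sum_le_sum_abs _ _).trans (Finset.sum_le_sum fun k hk => ?_)
              rw [Finset.mul_sum, ← Finset.sum_sub_distrib]
              have hkT : (k:ℝ) ≤ U^2 / p := (Nat.le_floor_iff (by positivity)).1 (mem_Ioc.1 hk).2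
              calc _ ≤ ∑ n ∈ Ioc k ⌊U⌋₊, (C * (p:ℝ)^(1/2:ℝ)) := by
                    refine (Finset.abs_sum_le_sum_abs _ _).trans (Finset.sum_le_sum fun n hn => ?_)
                    refine le_trans ?_ (hdiv p hp1)
                    have hz : 0 ≤ (p:ℝ) * min 1 ((U^2 / p - k) / n) :=
                      mul_nonneg hp0.le (le_min zero_le_one (div_nonneg (by linarith) (by positivity)))
                    have := cop_count p hp1 _ hz
                    rwa [← mul_assoc, ← e] at this
                _ ≤ _ := by
                    rw [Finset.sum_const, nsmul_eq_mul, Nat.card_Ioc]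
                    have : ((⌊U⌋₊ - k : ℕ):ℝ) ≤ U := le_trans (by exact_mod_cast Nat.sub_le _ _) (Nat.floor_le hU0.le)
                    gcongr
          _ ≤ U^2 / p * (U * (C * (p:ℝ)^(1/2:ℝ))) := by
              rw [Finset.sum_const, nsmul_eq_mul, Nat.card_Ioc, Nat.sub_zero]
              gcongr
              exact Nat.floor_le (by positivity)
          _ = _ := by
              have : (p:ℝ)^(-(1/2):ℝ) = (p:ℝ)^(1/2:ℝ) / p := by
                rw [show (-(1/2):ℝ) = 1/2 - 1 by norm_num, Real.rpow_sub hp0, Real.rpow_one]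
              rw [this]; field_simp
    _ ≤ ∑ p ∈ Icc 1 ⌊U^2⌋₊, C * U^3 * (p:ℝ)^(-(1/2):ℝ) := by
        refine Finset.sum_le_sum_of_subset_of_nonneg ?_ fun _ _ _ => by positivity
        intro p; simp only [mem_Ioc, mem_Icc]; omega
    _ = C * U^3 * ∑ p ∈ Icc 1 ⌊U^2⌋₊, (p:ℝ)^(-(1/2):ℝ) := by rw [Finset.mul_sum]
    _ ≤ C * U^3 * (2 * U) := by
        gcongr
        refine (psum (1/2) (by norm_num) (by norm_num) _).trans ?_
        rw [show (1 - 1/2:ℝ) = 1/2 by norm_num]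
        have : ((⌊U^2⌋₊ : ℕ):ℝ)^(1/2:ℝ) ≤ U := by
          calc _ ≤ (U^2)^(1/2:ℝ) := Real.rpow_le_rpow (by positivity) (Nat.floor_le (by positivity)) (by norm_num)
            _ = U := by rw [← Real.sqrt_eq_rpow, Real.sqrt_sq hU0.le]
        linarith
    _ = _ := by ring

end C4

namespace C4
open Finset

lemma h_est (U T : ℝ) (k : ℕ) (hk : 1 ≤ k) (hkT : (k:ℝ) ≤ T) (hTU : T ≤ U) :
    |∑ n ∈ Ioc k ⌊U⌋₊, min 1 ((T - k) / n) - (max (T - 2 * k) 0 + (T - k) * Real.log (U / max (k:ℝ) (T - k)))| ≤ 3 := by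
  have hk1 : (1:ℝ) ≤ k := by exact_mod_cast hk
  set D := T - k with hD
  set M := max (k:ℝ) D with hM
  have hD0 : 0 ≤ D := by linarith
  have hMk : (k:ℝ) ≤ M := le_max_left _ _
  have hMD : D ≤ M := le_max_right _ _
  have hM0 : 0 < M := by linarith
  have hMU : M ≤ U := max_le (by linarith) (by linarith)
  have hkM : k ≤ ⌊M⌋₊ := Nat.le_floor hMk
  have hMN : ⌊M⌋₊ ≤ ⌊U⌋₊ := Nat.floor_mono hMU
  rw [← Finset.sum_Ioc_consecutive _ hkM hMN]
  have e1 : ∑ n ∈ Ioc k ⌊M⌋₊, min 1 (D / n) = (⌊M⌋₊:ℝ) - k := by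
    rw [Finset.sum_congr rfl (g := fun _ => (1:ℝ))]
    · rw [Finset.sum_const, Nat.card_Ioc, nsmul_eq_mul, Nat.cast_sub hkM, mul_one]
    · intro n hn
      rw [mem_Ioc] at hn
      have h1 : (n:ℝ) ≤ M := (Nat.le_floor_iff hM0.le).1 hn.2
      have h2 : (k:ℝ) < n := by exact_mod_cast hn.1
      have h3 : (n:ℝ) ≤ D := by
        rcases le_max_iff.1 h1 with h | h
        · linarith
        · exact h
      apply min_eq_left
      rw [le_div_iff₀ (by linarith)]; linarith
  have e2 : ∑ n ∈ Ioc ⌊M⌋₊ ⌊U⌋₊, min 1 (D / n) = ∑ n ∈ Ioc ⌊M⌋₊ ⌊U⌋₊, D / n := by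
    refine Finset.sum_congr rfl fun n hn => ?_
    rw [mem_Ioc] at hn
    have h1 : M < n := (Nat.floor_lt hM0.le).1 hn.1
    apply min_eq_right
    rw [div_le_one (by linarith)]; linarith
  have e3 := L1 (fun x => D / x) (fun x => D * Real.log x) M U 1 hM0.le hMU
    (fun x hx => by
      have := (Real.hasDerivAt_log (by linarith [hx.1] : x ≠ 0)).const_mul D
      rwa [← div_eq_mul_inv] at this)
    (fun x hx => ⟨div_nonneg hD0 (by linarith [hx.1]), by
      rw [div_le_one (by linarith [hx.1])]; linarith [hx.1]⟩)
    (Or.inl fun x hx y hy hxy => by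
      have := hx.1
      simp only
      gcongr
      linarith)
  have e4 : max (T - 2 * k) 0 = M - k := by
    rw [hM, hD]
    rcases le_total (k:ℝ) (T - k) with h | h
    · rw [max_eq_right h, max_eq_left (by linarith)]; ring
    · rw [max_eq_left h, max_eq_right (by linarith)]; ring
  rw [e1, e2, e4, Real.log_div (by linarith) hM0.ne']
  rw [abs_le] at e3 ⊢
  have := Nat.floor_le hM0.le
  have := Nat.lt_floor_add_one M
  constructor <;> linarith [e3.1, e3.2]

noncomputable def g (T x : ℝ) : ℝ := max (T - 2 * x) 0 + (T - x) * Real.log (T / max x (T - x))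

lemma g_sum (T : ℝ) (hT : 1 ≤ T) :
    |∑ k ∈ Ioc 0 ⌊T⌋₊, g T k - (3/4 - Real.log 2 / 2) * T^2| ≤ 4 * T := by
  have hT0 : 0 < T := by linarith
  have hh : T / 2 ≤ T := by linarith
  have hl2 : Real.log 2 ≤ 1 := by linarith [Real.log_two_lt_d9]
  have hl0 : 0 ≤ Real.log 2 := Real.log_nonneg (by norm_num)
  rw [← Finset.sum_Ioc_consecutive _ (Nat.zero_le _) (Nat.floor_mono hh)]
  have p1 : ∑ k ∈ Ioc 0 ⌊T/2⌋₊, g T k = ∑ k ∈ Ioc ⌊(0:ℝ)⌋₊ ⌊T/2⌋₊, ((T - 2 * k) + (T - k) * (Real.log T - Real.log (T - k))) := by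
    rw [Nat.floor_zero]
    refine Finset.sum_congr rfl fun k hk => ?_
    have h1 : (k:ℝ) ≤ T/2 := (Nat.le_floor_iff (by positivity)).1 (mem_Ioc.1 hk).2
    unfold g
    rw [max_eq_left (by linarith), max_eq_right (by linarith), Real.log_div hT0.ne' (by linarith)]
  have p2 : ∑ k ∈ Ioc ⌊T/2⌋₊ ⌊T⌋₊, g T k = ∑ k ∈ Ioc ⌊T/2⌋₊ ⌊T⌋₊, ((T - k) * (Real.log T - Real.log k)) := by
    refine Finset.sum_congr rfl fun k hk => ?_
    have h1 : T/2 < (k:ℝ) := (Nat.floor_lt (by positivity)).1 (mem_Ioc.1 hk).1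
    unfold g
    rw [max_eq_right (by linarith), max_eq_left (by linarith), Real.log_div hT0.ne' (by linarith), zero_add]
  have q1d : ∀ x ∈ Set.Icc 0 (T/2), HasDerivAt (fun x : ℝ => (T - 2 * x) + (T - x) * (Real.log T - Real.log (T - x)))
      (-2 + (-1 * (Real.log T - Real.log (T - x)) + 1)) x := by
    intro x hx
    have hy : T - x ≠ 0 := by linarith [hx.2]
    have h1 : HasDerivAt (fun x : ℝ => T - x) (-1) x := by
      simpa using (hasDerivAt_id x).const_sub T
    have h2 : HasDerivAt (fun x : ℝ => T - 2 * x) (-2) x := by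
      simpa using ((hasDerivAt_id x).const_mul 2).const_sub T
    have h3 := (h1.log hy).const_sub (Real.log T)
    have h4 := h2.fun_add (h1.fun_mul h3)
    convert! h4 using 1
    field_simp
  have q1a : AntitoneOn (fun x : ℝ => (T - 2 * x) + (T - x) * (Real.log T - Real.log (T - x))) (Set.Icc 0 (T/2)) := by
    apply antitoneOn_of_deriv_nonpos (convex_Icc _ _)
    · exact fun x hx => (q1d x hx).continuousAt.continuousWithinAt
    · intro x hx; rw [interior_Icc] at hx
      exact (q1d x ⟨hx.1.le, hx.2.le⟩).differentiableAt.differentiableWithinAt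
    · intro x hx; rw [interior_Icc] at hx
      rw [(q1d x ⟨hx.1.le, hx.2.le⟩).deriv]
      have : Real.log (T - x) ≤ Real.log T := Real.log_le_log (by linarith [hx.2]) (by linarith [hx.1])
      linarith
  have r1 := L1 (fun x => (T - 2 * x) + (T - x) * (Real.log T - Real.log (T - x)))
    (fun x => T * x - x^2 - ((T - x)^2 / 2 * (Real.log T - Real.log (T - x)) + (T - x)^2/4)) 0 (T/2) T le_rfl (by linarith)
    (by
      intro x hx
      have hy : T - x ≠ 0 := by linarith [hx.2]
      have h1 : HasDerivAt (fun x : ℝ => T - x) (-1) x := by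
        simpa using (hasDerivAt_id x).const_sub T
      have h2 : HasDerivAt (fun x : ℝ => T * x - x^2) (T - 2 * x) x := by
        simpa using ((hasDerivAt_id x).const_mul T).fun_sub ((hasDerivAt_id x).fun_pow 2)
      have h3 := (h1.log hy).const_sub (Real.log T)
      have h5 := h1.fun_pow 2
      have h4 := h2.fun_sub (((h5.div_const 2).fun_mul h3).fun_add (h5.div_const 4))
      convert! h4 using 1
      field_simp
      ring)
    (by
      intro x hx
      constructor
      · have : Real.log (T - x) ≤ Real.log T := Real.log_le_log (by linarith [hx.2]) (by linarith [hx.1])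
        have : 0 ≤ (T - x) * (Real.log T - Real.log (T - x)) := mul_nonneg (by linarith [hx.2]) (by linarith)
        linarith [hx.2]
      · have := q1a ⟨le_rfl, by linarith⟩ hx hx.1
        simpa using this)
    (Or.inl q1a)
  have lx : ∀ x ∈ Set.Icc (T/2) T, Real.log x ≤ Real.log T := fun x hx =>
    Real.log_le_log (by linarith [hx.1]) hx.2
  have lT2 : Real.log (T/2) = Real.log T - Real.log 2 := Real.log_div hT0.ne' (by norm_num)
  have r2 := L1 (fun x => (T - x) * (Real.log T - Real.log x))
    (fun x => T * (x * (Real.log T - Real.log x) + x) - (x^2/2 * (Real.log T - Real.log x) + x^2/4)) (T/2) T T (by linarith) hh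
    (by
      intro x hx
      have hy : x ≠ 0 := by linarith [hx.1]
      have h3 := (Real.hasDerivAt_log hy).const_sub (Real.log T)
      have h5 := (hasDerivAt_id x).fun_pow 2
      have h4 := ((((hasDerivAt_id x).fun_mul h3).fun_add (hasDerivAt_id x)).const_mul T).fun_sub
        (((h5.div_const 2).fun_mul h3).fun_add (h5.div_const 4))
      convert! h4 using 1
      simp only [id]
      field_simp
      ring)
    (by
      intro x hx
      have h1 := lx x hx
      have h2 : Real.log (T/2) ≤ Real.log x := Real.log_le_log (by linarith) hx.1
      refine ⟨mul_nonneg (by linarith [hx.2]) (by linarith), ?_⟩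
      calc _ ≤ T * 1 := mul_le_mul (by linarith [hx.1]) (by linarith) (by linarith) hT0.le
        _ = T := mul_one _)
    (Or.inl fun x hx y hy hxy => by
      have h1 := lx y hy
      have : Real.log x ≤ Real.log y := Real.log_le_log (by linarith [hx.1]) hxy
      exact mul_le_mul (by linarith) (by linarith) (by linarith) (by linarith [hx.2]))
  rw [p1, p2]
  simp only [sub_zero, show T - T/2 = T/2 by ring, lT2] at r1 r2
  rw [abs_le] at r1 r2 ⊢
  constructor <;> nlinarith [r1.1, r1.2, r2.1, r2.2]

noncomputable def cc : ℝ := 3/4 - Real.log 2 / 2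

lemma H_est (U T : ℝ) (hT : 1 ≤ T) (hTU : T ≤ U) :
    |H ⌊U⌋₊ T - ((∑ k ∈ Ioc 0 ⌊T⌋₊, (T - k)) * Real.log (U / T) + cc * T^2)| ≤ 7 * T := by
  have hT0 : 0 < T := by linarith
  have h1 := g_sum T hT
  have h2 : |H ⌊U⌋₊ T - ((∑ k ∈ Ioc 0 ⌊T⌋₊, (T - k)) * Real.log (U / T) + ∑ k ∈ Ioc 0 ⌊T⌋₊, g T k)| ≤ 3 * T := by
    unfold H
    rw [Finset.sum_mul, ← Finset.sum_add_distrib, ← Finset.sum_sub_distrib]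
    calc _ ≤ ∑ k ∈ Ioc 0 ⌊T⌋₊, (3:ℝ) := by
          refine (Finset.abs_sum_le_sum_abs _ _).trans (Finset.sum_le_sum fun k hk => ?_)
          rw [mem_Ioc] at hk
          have hkT : (k:ℝ) ≤ T := (Nat.le_floor_iff hT0.le).1 hk.2
          have hk1 : (1:ℝ) ≤ k := by exact_mod_cast hk.1
          have h := h_est U T k hk.1 hkT hTU
          have hM : 0 < max (k:ℝ) (T - k) := lt_max_of_lt_left (by linarith)
          have e : (T - k) * Real.log (U / T) + g T k = max (T - 2 * k) 0 + (T - k) * Real.log (U / max (k:ℝ) (T - k)) := by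
            unfold g
            rw [Real.log_div (by linarith) hT0.ne', Real.log_div hT0.ne' hM.ne', Real.log_div (by linarith) hM.ne']
            ring
          rwa [e]
      _ ≤ 3 * T := by
          rw [Finset.sum_const, nsmul_eq_mul, Nat.card_Ioc, Nat.sub_zero]
          have := Nat.floor_le hT0.le
          linarith
  unfold cc
  rw [abs_le] at *
  constructor <;> linarith [h1.1, h1.2, h2.1, h2.2]

end C4

namespace C4
open Finset

lemma harm_est (U : ℝ) (hU : 2 ≤ U) :
    |∑ k ∈ Icc 1 ⌊U⌋₊, (1 / k : ℝ) - Real.log U - Real.eulerMascheroniConstant| ≤ 1 / (⌊U⌋₊:ℝ) := by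
  set N := ⌊U⌋₊ with hN
  have hN2 : 2 ≤ N := Nat.le_floor (by simpa using hU)
  have hN0 : (0:ℝ) < N := by exact_mod_cast (by omega : 0 < N)
  have h1 := Real.eulerMascheroniSeq_lt_eulerMascheroniConstant N
  have h2 := Real.eulerMascheroniConstant_lt_eulerMascheroniSeq' N
  unfold Real.eulerMascheroniSeq at h1
  unfold Real.eulerMascheroniSeq' at h2
  rw [if_neg (by omega)] at h2
  have e : ((harmonic N : ℚ) : ℝ) = ∑ k ∈ Icc 1 N, (1 / k : ℝ) := by
    rw [harmonic_eq_sum_Icc]; push_cast; simp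
  rw [e] at h1 h2
  have h3 : Real.log N ≤ Real.log U := Real.log_le_log hN0 (Nat.floor_le (by linarith))
  have h4 : Real.log U ≤ Real.log (N + 1) := Real.log_le_log (by linarith) (Nat.lt_floor_add_one U).le
  have h5 : Real.log (N + 1) - Real.log N ≤ 1 / N := by
    rw [← Real.log_div (by positivity) hN0.ne']
    refine (Real.log_le_sub_one_of_pos (by positivity)).trans (le_of_eq ?_)
    field_simp
    ring
  rw [abs_le]
  constructor <;> linarith

lemma log_est (U : ℝ) (hU : 2 ≤ U) :
    |∑ k ∈ Icc 1 ⌊U⌋₊, ((1 + Real.log k) / k : ℝ) - (1 + Real.log U + (Real.log U)^2 / 2)| ≤ 2 := by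
  have hN2 : 2 ≤ ⌊U⌋₊ := Nat.le_floor (by simpa using hU)
  have h := L1 (fun x => (1 + Real.log x) / x) (fun x => Real.log x + (Real.log x)^2/2) 1 U 1 (by norm_num) (by linarith)
    (by
      intro x hx
      have hx0 : x ≠ 0 := by linarith [hx.1]
      have h1 := Real.hasDerivAt_log hx0
      have h2 := h1.fun_add ((h1.fun_pow 2).div_const 2)
      convert! h2 using 1
      field_simp
      ring)
    (by
      intro x hx
      have hx0 : 0 < x := by linarith [hx.1]
      have := Real.log_nonneg hx.1
      refine ⟨by positivity, ?_⟩
      rw [div_le_one hx0]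
      linarith [Real.log_le_sub_one_of_pos hx0])
    (by
      left
      intro x hx y hy hxy
      have hx0 : 0 < x := by linarith [hx.1]
      have hy0 : 0 < y := by linarith [hy.1]
      have h1 := Real.log_nonneg hx.1
      simp only
      rw [div_le_div_iff₀ hy0 hx0]
      have h2 := Real.log_le_sub_one_of_pos (div_pos hy0 hx0)
      rw [Real.log_div hy0.ne' hx0.ne'] at h2
      have h3 : (y / x) * x = y := by field_simp
      nlinarith)
  have e : ∑ k ∈ Icc 1 ⌊U⌋₊, ((1 + Real.log k) / k : ℝ) = 1 + ∑ k ∈ Ioc ⌊(1:ℝ)⌋₊ ⌊U⌋₊, ((1 + Real.log k) / k : ℝ) := by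
    rw [Nat.floor_one, ← Finset.add_sum_Ioc_eq_sum_Icc (by omega)]
    simp
  rw [e]
  simp only [Real.log_one] at h
  rw [abs_le] at h ⊢
  constructor <;> linarith [h.1, h.2]

lemma S_est (U : ℝ) (hU : 2 ≤ U) :
    |∑ k ∈ Icc 1 ⌊U⌋₊, (1 / k : ℝ) * ((Real.log U - Real.log k) / 2 - 3/4)
      - ((Real.log U)^2 / 4 + Real.eulerMascheroniConstant / 2 * Real.log U - 3/4 * Real.log U)| ≤ 6 := by
  have h1 := harm_est U hU
  have h2 := log_est U hU
  have hN2 : 2 ≤ ⌊U⌋₊ := Nat.le_floor (by simpa using hU)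
  have hN2' : (2:ℝ) ≤ (⌊U⌋₊:ℝ) := by exact_mod_cast hN2
  have hN0 : (0:ℝ) < (⌊U⌋₊:ℝ) := by linarith
  have hLN : Real.log U * (1 / (⌊U⌋₊:ℝ)) ≤ 2 := by
    rw [mul_one_div, div_le_iff₀ hN0]
    linarith [Real.log_le_sub_one_of_pos (by linarith : 0 < U), Nat.lt_floor_add_one U]
  have hL0 : 0 ≤ Real.log U := Real.log_nonneg (by linarith)
  have hN1 : 1 / (⌊U⌋₊:ℝ) ≤ 1 := by rw [div_le_one hN0]; linarith
  have e : ∑ k ∈ Icc 1 ⌊U⌋₊, (1 / k : ℝ) * ((Real.log U - Real.log k) / 2 - 3/4) =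
      (Real.log U / 2 - 1/4) * ∑ k ∈ Icc 1 ⌊U⌋₊, (1 / k : ℝ) - 1/2 * ∑ k ∈ Icc 1 ⌊U⌋₊, ((1 + Real.log k) / k : ℝ) := by
    rw [Finset.mul_sum, Finset.mul_sum, ← Finset.sum_sub_distrib]
    refine Finset.sum_congr rfl fun k _ => by ring
  rw [e]
  have g1 := Real.one_half_lt_eulerMascheroniConstant
  have g2 := Real.eulerMascheroniConstant_lt_two_thirds
  set γ := Real.eulerMascheroniConstant
  set L := Real.log U
  set A := ∑ k ∈ Icc 1 ⌊U⌋₊, (1 / k : ℝ)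
  set Q := ∑ k ∈ Icc 1 ⌊U⌋₊, ((1 + Real.log k) / k : ℝ)
  obtain ⟨a1, a2⟩ := abs_le.1 h1
  obtain ⟨b1, b2⟩ := abs_le.1 h2
  have c : |L * (A - L - γ)| ≤ 2 := by
    rw [abs_mul, abs_of_nonneg hL0]
    exact (mul_le_mul_of_nonneg_left h1 hL0).trans hLN
  obtain ⟨c1, c2⟩ := abs_le.1 c
  rw [abs_le]
  constructor <;> nlinarith

lemma pi_z : 6 / Real.pi^2 ≤ 1 := by
  rw [div_le_one (by positivity)]
  nlinarith [Real.pi_gt_three]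

lemma M1_est (U : ℝ) (hU : 2 ≤ U) :
    |∑ p ∈ Ioc ⌊U⌋₊ ⌊U^2⌋₊, ((Nat.totient p : ℕ):ℝ) / p * (1 / p) - 6 / Real.pi^2 * Real.log U| ≤
      1 / U * (4 + 4 * Real.log U) := by
  have hU0 : 0 < U := by linarith
  have h := L2 (fun x => 1 / x) Real.log U (U^2) (1/U) (by linarith) (by nlinarith)
    (fun x hx => by rw [one_div]; exact Real.hasDerivAt_log (by linarith [hx.1]))
    (fun x hx => by
      have := hx.1
      have : 0 < x := by linarith
      exact ⟨by positivity, by gcongr⟩)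
    (Or.inl fun x hx y hy hxy => by
      have := hx.1
      have : 0 < x := by linarith
      simp only
      gcongr)
  rw [Real.log_pow] at h
  push_cast at h
  rw [show 2 * Real.log U - Real.log U = Real.log U by ring, show 2 * (2 * Real.log U) = 4 * Real.log U by ring] at h
  exact h

lemma k_est (U : ℝ) (hU : 2 ≤ U) (k : ℕ) (hk : 1 ≤ k) (hkU : (k:ℝ) ≤ U) :
    |∑ p ∈ Ioc ⌊U⌋₊ ⌊U^2/k⌋₊, ((Nat.totient p : ℕ):ℝ) / p * ((U^2 - k * p) * (Real.log p - Real.log U))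
      - 6 / Real.pi^2 * (U^4 * ((1 / k) * ((Real.log U - Real.log k) / 2 - 3/4)))| ≤
      8 * U^2 * (Real.log U * (1 + Real.log U)) + 2 * U^3 := by
  have hU0 : 0 < U := by linarith
  have hk1 : (1:ℝ) ≤ k := by exact_mod_cast hk
  have hk0 : (0:ℝ) < k := by linarith
  set b := U^2 / k with hb
  have hkb : k * b = U^2 := by rw [hb]; field_simp
  have hb0 : 0 < b := by positivity
  have hUb : U ≤ b := by rw [hb, le_div_iff₀ hk0]; nlinarith
  have hbU : b ≤ U^2 := div_le_self (by positivity) hk1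
  have hlb : Real.log b = 2 * Real.log U - Real.log k := by
    rw [hb, Real.log_div (by positivity) hk0.ne', Real.log_pow]; push_cast; ring
  have hlk : 0 ≤ Real.log k := Real.log_nonneg hk1
  have hL0 : 0 ≤ Real.log U := Real.log_nonneg (by linarith)
  set L := Real.log U with hL
  have lo : ∀ x ∈ Set.Icc U b, L ≤ Real.log x := fun x hx => Real.log_le_log hU0 hx.1
  have hi : ∀ x ∈ Set.Icc U b, Real.log x ≤ 2 * L := fun x hx => by
    have := Real.log_le_log (by linarith [hx.1]) hx.2
    linarith
  have h1 := L2 (fun x => U^2 * (Real.log x - L)) (fun x => U^2 * (x * (Real.log x - L) - x)) U b (U^2 * L) (by linarith) hUb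
    (by
      intro x hx
      have hx0 : x ≠ 0 := by linarith [hx.1]
      have h := ((((hasDerivAt_id x).fun_mul ((Real.hasDerivAt_log hx0).sub_const L))).fun_sub (hasDerivAt_id x)).const_mul (U^2)
      convert! h using 1
      simp only [id]
      field_simp
      ring)
    (fun x hx => ⟨mul_nonneg (by positivity) (by linarith [lo x hx]), by
      have := hi x hx
      gcongr
      linarith⟩)
    (Or.inr fun x hx y hy hxy => by
      have : 0 < x := by linarith [hx.1]
      simp only
      gcongr)
  have h2 := L2 (fun x => k * x * (Real.log x - L)) (fun x => k * (x^2/2 * (Real.log x - L) - x^2/4)) U b (U^2 * L) (by linarith) hUb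
    (by
      intro x hx
      have hx0 : x ≠ 0 := by linarith [hx.1]
      have h5 := (hasDerivAt_id x).fun_pow 2
      have h := ((((h5.div_const 2).fun_mul ((Real.hasDerivAt_log hx0).sub_const L))).fun_sub (h5.div_const 4)).const_mul (k:ℝ)
      convert! h using 1
      simp only [id]
      field_simp
      ring)
    (fun x hx => by
      have hx0 : 0 < x := by linarith [hx.1]
      refine ⟨mul_nonneg (by positivity) (by linarith [lo x hx]), ?_⟩
      refine mul_le_mul ?_ (by linarith [hi x hx]) (by linarith [lo x hx]) (by positivity)
      rw [← hkb]
      exact mul_le_mul_of_nonneg_left hx.2 hk0.le)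
    (Or.inr fun x hx y hy hxy => by
      have hx0 : 0 < x := by linarith [hx.1]
      have hy0 : 0 < y := by linarith [hy.1]
      have := lo x hx
      simp only
      have hl := Real.log_le_log hx0 hxy
      refine mul_le_mul ?_ (by linarith) (by linarith) (by positivity)
      gcongr)
  have e : ∑ p ∈ Ioc ⌊U⌋₊ ⌊b⌋₊, ((Nat.totient p : ℕ):ℝ) / p * ((U^2 - k * p) * (Real.log p - L)) =
      ∑ p ∈ Ioc ⌊U⌋₊ ⌊b⌋₊, ((Nat.totient p : ℕ):ℝ) / p * (U^2 * (Real.log p - L)) -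
      ∑ p ∈ Ioc ⌊U⌋₊ ⌊b⌋₊, ((Nat.totient p : ℕ):ℝ) / p * (k * p * (Real.log p - L)) := by
    rw [← Finset.sum_sub_distrib]
    refine Finset.sum_congr rfl fun p _ => by ring
  rw [e]
  have hkb2 : (k:ℝ) * b^2 = U^2 * b := by rw [sq, ← mul_assoc, hkb]
  have hU4 : U^4 * (1 / k) = U^2 * b := by rw [hb]; field_simp
  have d : (U^2 * (b * (Real.log b - L) - b) - U^2 * (U * (L - L) - U)) -
      (k * (b^2/2 * (Real.log b - L) - b^2/4) - k * (U^2/2 * (L - L) - U^2/4)) =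
      U^4 * ((1 / k) * ((L - Real.log k) / 2 - 3/4)) + (U^3 - k * U^2 / 4) := by
    rw [← mul_assoc (U^4), hU4, hlb]
    linear_combination (-(1/2) * (2 * L - Real.log k - L) + 1/4) * hkb2
  have hz := pi_z
  have hz0 : 0 ≤ 6 / Real.pi^2 := by positivity
  set z := 6 / Real.pi^2
  have hr : |z * (U^3 - k * U^2 / 4)| ≤ U^3 := by
    have h3 : 0 ≤ U^3 - k * U^2/4 := by nlinarith [sq_nonneg U]
    have h4 : U^3 - k * U^2/4 ≤ U^3 := by nlinarith [sq_nonneg U]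
    rw [abs_mul, abs_of_nonneg hz0, abs_of_nonneg h3]
    calc _ ≤ 1 * (U^3) := by gcongr
      _ = _ := one_mul _
  have hE : U^2 * L * (4 + 2 * Real.log b) ≤ 4 * U^2 * (L * (1 + L)) := by
    have : Real.log b ≤ 2 * L := by linarith
    calc _ ≤ U^2 * L * (4 + 2 * (2 * L)) := by gcongr
      _ = _ := by ring
  have hU3 : 0 ≤ U^3 := by positivity
  have d' := congrArg (fun t => z * t) d
  simp only [mul_add, mul_sub z] at d'
  rw [← hL] at h1 h2
  simp only [mul_sub z] at h1 h2 hr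
  rw [abs_le] at h1 h2 hr ⊢
  constructor <;> linarith [h1.1, h1.2, h2.1, h2.2, hr.1, hr.2]

end C4

namespace C4
open Finset

lemma swap_est (U : ℝ) (hU : 2 ≤ U) :
    ∑ p ∈ Ioc ⌊U⌋₊ ⌊U^2⌋₊, ((Nat.totient p : ℕ):ℝ) * ((∑ k ∈ Ioc 0 ⌊U^2/p⌋₊, (U^2 / p - k)) * Real.log (U / (U^2 / p))) =
    ∑ k ∈ Icc 1 ⌊U⌋₊, ∑ p ∈ Ioc ⌊U⌋₊ ⌊U^2/k⌋₊, ((Nat.totient p : ℕ):ℝ) / p * ((U^2 - k * p) * (Real.log p - Real.log U)) := by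
  have hU0 : 0 < U := by linarith
  simp only [Finset.sum_mul, Finset.mul_sum]
  rw [Finset.sum_comm' (s' := fun k => Ioc ⌊U⌋₊ ⌊U^2/k⌋₊) (t' := Icc 1 ⌊U⌋₊)]
  · refine Finset.sum_congr rfl fun k hk => Finset.sum_congr rfl fun p hp => ?_
    rw [mem_Ioc] at hp
    have hp0 : (0:ℝ) < p := by exact_mod_cast (by omega : 0 < p)
    have : U / (U^2 / p) = p / U := by field_simp
    rw [this, Real.log_div hp0.ne' hU0.ne']
    field_simp
  · intro p k
    simp only [mem_Ioc, mem_Icc]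
    constructor
    · rintro ⟨⟨h1, h2⟩, h3, h4⟩
      have hpU : U < p := (Nat.floor_lt hU0.le).1 h1
      have hp0 : (0:ℝ) < p := by linarith
      have hk0 : (0:ℝ) < k := by exact_mod_cast h3
      rw [Nat.le_floor_iff (by positivity), le_div_iff₀ hp0] at h4
      rw [Nat.le_floor_iff (by positivity), le_div_iff₀ hk0, Nat.le_floor_iff hU0.le]
      refine ⟨⟨h1, by linarith⟩, h3, ?_⟩
      by_contra hc
      push Not at hc
      nlinarith
    · rintro ⟨⟨h1, h2⟩, h3, h4⟩
      have hpU : U < p := (Nat.floor_lt hU0.le).1 h1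
      have hp0 : (0:ℝ) < p := by linarith
      have hk0 : (0:ℝ) < k := by exact_mod_cast (by omega : 0 < k)
      have hk1 : (1:ℝ) ≤ k := by exact_mod_cast h3
      rw [Nat.le_floor_iff (by positivity), le_div_iff₀ hk0] at h2
      rw [Nat.le_floor_iff (by positivity), Nat.le_floor_iff (by positivity), le_div_iff₀ hp0]
      refine ⟨⟨h1, by nlinarith⟩, h3, by linarith⟩

lemma R1_est : ∃ C : ℝ, 0 ≤ C ∧ ∀ U : ℝ, 2 ≤ U →
    |R1 ⌊U⌋₊ ⌊U^2⌋₊ - 6 / Real.pi^2 * (U^4 * ((Real.log U)^2 / 4 + Real.log U / 2 * (Real.eulerMascheroniConstant - Real.log 2)))| ≤ C * U^4 := by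
  obtain ⟨C1, hC1, hR⟩ := R1_H
  obtain ⟨C2, hC2, hlog⟩ := log_bound (1/2) (by norm_num)
  refine ⟨C1 + 7 + 4 + (8 * C2^2 + 2) + 6, by positivity, fun U hU => ?_⟩
  have hU0 : 0 < U := by linarith
  have h1 := hR U hU
  have hL0 : 0 ≤ Real.log U := Real.log_nonneg (by linarith)
  have hlU := Real.log_le_sub_one_of_pos hU0
  have hz := pi_z
  have hz0 : 0 ≤ 6 / Real.pi^2 := by positivity
  have hM1 := M1_est U hU
  have hS := S_est U hU
  have hsw := swap_est U hU
  have hcc0 : 0 ≤ cc := by unfold cc; linarith [Real.log_two_lt_d9]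
  have hcc1 : cc ≤ 1 := by unfold cc; linarith [Real.log_two_gt_d9]
  have hcc : cc = 3/4 - Real.log 2 / 2 := rfl
  set L := Real.log U with hL
  set z := 6 / Real.pi^2
  set γ := Real.eulerMascheroniConstant
  have hLL : L * (1 + L) ≤ C2^2 * U := by
    have h := hlog U (by linarith)
    calc L * (1 + L) ≤ (1 + L) * (1 + L) := by gcongr; linarith
      _ ≤ (C2 * U^(1/2:ℝ)) * (C2 * U^(1/2:ℝ)) := by gcongr
      _ = C2^2 * (U^(1/2:ℝ) * U^(1/2:ℝ)) := by ring
      _ = C2^2 * U := by rw [← Real.rpow_add hU0]; norm_num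
  -- step H
  have hH : |∑ p ∈ Ioc ⌊U⌋₊ ⌊U^2⌋₊, ((Nat.totient p : ℕ):ℝ) * H ⌊U⌋₊ (U^2 / p) -
      (∑ p ∈ Ioc ⌊U⌋₊ ⌊U^2⌋₊, ((Nat.totient p : ℕ):ℝ) * ((∑ k ∈ Ioc 0 ⌊U^2/p⌋₊, (U^2 / p - k)) * Real.log (U / (U^2 / p)))
       + cc * U^4 * ∑ p ∈ Ioc ⌊U⌋₊ ⌊U^2⌋₊, ((Nat.totient p : ℕ):ℝ) / p * (1 / p))| ≤ 7 * U^4 := by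
    rw [Finset.mul_sum, ← Finset.sum_add_distrib, ← Finset.sum_sub_distrib]
    calc _ ≤ ∑ p ∈ Ioc ⌊U⌋₊ ⌊U^2⌋₊, 7 * U^2 := by
          refine (Finset.abs_sum_le_sum_abs _ _).trans (Finset.sum_le_sum fun p hp => ?_)
          rw [mem_Ioc] at hp
          have hpU : U < p := (Nat.floor_lt hU0.le).1 hp.1
          have hpX : (p:ℝ) ≤ U^2 := (Nat.le_floor_iff (by positivity)).1 hp.2
          have hp0 : (0:ℝ) < p := by linarith
          have h := H_est U (U^2/p) (by rw [le_div_iff₀ hp0]; linarith) (by rw [div_le_iff₀ hp0]; nlinarith)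
          have e : ((Nat.totient p : ℕ):ℝ) * H ⌊U⌋₊ (U^2 / p) -
            (((Nat.totient p : ℕ):ℝ) * ((∑ k ∈ Ioc 0 ⌊U^2/p⌋₊, (U^2 / p - k)) * Real.log (U / (U^2 / p))) + cc * U^4 * (((Nat.totient p : ℕ):ℝ) / p * (1 / p)))
            = ((Nat.totient p : ℕ):ℝ) * (H ⌊U⌋₊ (U^2 / p) - ((∑ k ∈ Ioc 0 ⌊U^2/p⌋₊, (U^2 / p - k)) * Real.log (U / (U^2 / p)) + cc * (U^2/p)^2)) := by
            field_simp
          rw [e, abs_mul, Nat.abs_cast]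
          calc _ ≤ (p:ℝ) * (7 * (U^2/p)) := by
                have : ((Nat.totient p : ℕ):ℝ) ≤ p := by exact_mod_cast Nat.totient_le p
                gcongr
            _ = _ := by field_simp
      _ ≤ U^2 * (7 * U^2) := by
          rw [Finset.sum_const, nsmul_eq_mul, Nat.card_Ioc]
          have : ((⌊U^2⌋₊ - ⌊U⌋₊ : ℕ):ℝ) ≤ U^2 := le_trans (by exact_mod_cast Nat.sub_le _ _) (Nat.floor_le (by positivity))
          gcongr
      _ = _ := by ring
  have hA : |∑ k ∈ Icc 1 ⌊U⌋₊, ∑ p ∈ Ioc ⌊U⌋₊ ⌊U^2/k⌋₊, ((Nat.totient p : ℕ):ℝ) / p * ((U^2 - k * p) * (Real.log p - L))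
      - z * (U^4 * ∑ k ∈ Icc 1 ⌊U⌋₊, (1 / k : ℝ) * ((L - Real.log k) / 2 - 3/4))| ≤ (8 * C2^2 + 2) * U^4 := by
    rw [Finset.mul_sum, Finset.mul_sum, ← Finset.sum_sub_distrib]
    calc _ ≤ ∑ k ∈ Icc 1 ⌊U⌋₊, (8 * U^2 * (C2^2 * U) + 2 * U^3) := by
          refine (Finset.abs_sum_le_sum_abs _ _).trans (Finset.sum_le_sum fun k hk => ?_)
          rw [mem_Icc] at hk
          refine (k_est U hU k hk.1 ((Nat.le_floor_iff hU0.le).1 hk.2)).trans ?_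
          gcongr
      _ ≤ U * (8 * U^2 * (C2^2 * U) + 2 * U^3) := by
          rw [Finset.sum_const, nsmul_eq_mul, Nat.card_Icc, Nat.add_sub_cancel]
          gcongr
          exact Nat.floor_le hU0.le
      _ = _ := by ring
  rw [hsw] at hH
  set SA := ∑ k ∈ Icc 1 ⌊U⌋₊, ∑ p ∈ Ioc ⌊U⌋₊ ⌊U^2/k⌋₊, ((Nat.totient p : ℕ):ℝ) / p * ((U^2 - k * p) * (Real.log p - L))
  set S := ∑ k ∈ Icc 1 ⌊U⌋₊, (1 / k : ℝ) * ((L - Real.log k) / 2 - 3/4)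
  set SM := ∑ p ∈ Ioc ⌊U⌋₊ ⌊U^2⌋₊, ((Nat.totient p : ℕ):ℝ) / p * (1 / p)
  set SH := ∑ p ∈ Ioc ⌊U⌋₊ ⌊U^2⌋₊, ((Nat.totient p : ℕ):ℝ) * H ⌊U⌋₊ (U^2 / p)
  have hM1' : |cc * U^4 * (SM - z * L)| ≤ 4 * U^4 := by
    rw [abs_mul, abs_of_nonneg (by positivity : 0 ≤ cc * U^4)]
    have : 1 / U * (4 + 4 * L) ≤ 4 := by
      rw [one_div_mul_eq_div, div_le_iff₀ hU0]; linarith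
    calc _ ≤ 1 * U^4 * 4 := by
          gcongr
          exact hM1.trans this
      _ = _ := by ring
  have hS' : |z * U^4 * (S - (L^2 / 4 + γ / 2 * L - 3/4 * L))| ≤ 6 * U^4 := by
    rw [abs_mul, abs_of_nonneg (by positivity : 0 ≤ z * U^4)]
    calc _ ≤ 1 * U^4 * 6 := by gcongr
      _ = _ := by ring
  have key : R1 ⌊U⌋₊ ⌊U^2⌋₊ - z * (U^4 * (L^2 / 4 + L / 2 * (γ - Real.log 2))) =
      (R1 ⌊U⌋₊ ⌊U^2⌋₊ - SH) + (SH - (SA + cc * U^4 * SM)) + cc * U^4 * (SM - z * L) + (SA - z * (U^4 * S))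
      + z * U^4 * (S - (L^2 / 4 + γ / 2 * L - 3/4 * L)) := by
    rw [hcc]; ring
  rw [key]
  refine (abs_add_le _ _).trans ?_
  have a1 := abs_add_le ((R1 ⌊U⌋₊ ⌊U^2⌋₊ - SH) + (SH - (SA + cc * U^4 * SM)) + cc * U^4 * (SM - z * L)) (SA - z * (U^4 * S))
  have a2 := abs_add_le ((R1 ⌊U⌋₊ ⌊U^2⌋₊ - SH) + (SH - (SA + cc * U^4 * SM))) (cc * U^4 * (SM - z * L))
  have a3 := abs_add_le (R1 ⌊U⌋₊ ⌊U^2⌋₊ - SH) (SH - (SA + cc * U^4 * SM))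
  linarith

end C4

/-- **Proposition 3.1 (4).** `R_{4,α}(U) = α U⁴(log U)²/(4ζ(2))
+ (α U⁴ log U/(2ζ(2)))(γ - log 2) + O(U⁴)` with an absolute implied constant. -/
theorem case4_count :
    ∃ C : ℝ, 0 < C ∧ ∀ α : ℚ, 0 < α → α ≤ 1 → ∀ U : ℝ, 2 ≤ U →
      |(({x : ℕ × ℕ × ℕ × ℕ | Case4 α U x.1 x.2.1 x.2.2.1 x.2.2.2}.ncard : ℝ))
        - (α : ℝ) * U^4 * (Real.log U)^2 / (4 * (Real.pi^2/6))
        - (α : ℝ) * U^4 * Real.log U / (2 * (Real.pi^2/6)) *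
            (Real.eulerMascheroniConstant - Real.log 2)|
      ≤ C * U^4 := by
  obtain ⟨C1, hC1, h1⟩ := C4.reduction
  obtain ⟨C2, hC2, h2⟩ := C4.R1_est
  refine ⟨C1 + C2, by linarith, fun α h0 hα U hU => ?_⟩
  have g1 := h1 α h0 hα U hU
  have g2 := h2 U hU
  have hα0 : (0:ℝ) < α := by exact_mod_cast h0
  have hα1 : (α:ℝ) ≤ 1 := by exact_mod_cast hα
  have g3 := mul_le_mul hα1 g2 (abs_nonneg _) zero_le_one
  rw [← abs_of_pos hα0, ← abs_mul, one_mul] at g3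
  have hpi : Real.pi ≠ 0 := Real.pi_ne_zero
  have e : (({x : ℕ × ℕ × ℕ × ℕ | Case4 α U x.1 x.2.1 x.2.2.1 x.2.2.2}.ncard : ℝ))
        - (α : ℝ) * U^4 * (Real.log U)^2 / (4 * (Real.pi^2/6))
        - (α : ℝ) * U^4 * Real.log U / (2 * (Real.pi^2/6)) *
            (Real.eulerMascheroniConstant - Real.log 2) =
      ((({x : ℕ × ℕ × ℕ × ℕ | Case4 α U x.1 x.2.1 x.2.2.1 x.2.2.2}.ncard : ℝ)) - α * C4.R1 ⌊U⌋₊ ⌊U^2⌋₊)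
      + α * (C4.R1 ⌊U⌋₊ ⌊U^2⌋₊ - 6 / Real.pi^2 * (U^4 * ((Real.log U)^2 / 4 + Real.log U / 2 * (Real.eulerMascheroniConstant - Real.log 2)))) := by
    field_simp
    ring
  rw [e]
  refine (abs_add_le _ _).trans ?_
  linarith
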